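/- Let λ be a partition with at most n rows. For each partition μ with at most n parts, let Y_μ(λ) denote the set of Yamanouchi elements of SVT^n(λ) of weight μ. Then there is a bijection from SVT^n(λ) onto the disjoint union over partitions μ of Y_μ(λ) × SSYT^n(μ), which preserves weights and intertwines the crystal operators: e_i and f_i on SVT^n(λ) correspond to e_i and f_i acting on the SSYT^n(μ) factor (with the Y_μ(λ) factor unchanged). In particular, SVT^n(λ) decomposes as a direct sum of copies of the crystals SSYT^n(μ), the crystal SSYT^n(μ) occurring with multiplicity M_λ^μ = |Y_μ(λ)|. -/

import Mathlib

open scoped Classical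

noncomputable section

namespace SVTCrystal

/-- A filling assigns to each (row, column) position (0-indexed) a finite set of entries. -/
abbrev Filling : Type := ℕ → ℕ → Finset ℕ

/-- `lam` is a partition shape with at most `n` rows. -/
def IsPartitionShape (n : ℕ) (lam : ℕ → ℕ) : Prop :=
  (∀ r, lam (r + 1) ≤ lam r) ∧ (∀ r, n ≤ r → lam r = 0)

/-- Semistandard set-valued tableau of shape `lam` with entries in `{1,…,n}`. -/
structure IsSVT (n : ℕ) (lam : ℕ → ℕ) (t : Filling) : Prop where
  boxNonempty : ∀ r c, c < lam r → (t r c).Nonempty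
  emptyOutside : ∀ r c, ¬ c < lam r → t r c = ∅
  entryBounds : ∀ r c a, a ∈ t r c → 1 ≤ a ∧ a ≤ n
  rowWeak : ∀ r c a b, a ∈ t r c → b ∈ t r (c + 1) → a ≤ b
  colStrict : ∀ r c a b, a ∈ t r c → b ∈ t (r + 1) c → a < b

/-- Semistandard Young tableau: a set-valued tableau all of whose boxes are singletons. -/
def IsSSYT (n : ℕ) (lam : ℕ → ℕ) (t : Filling) : Prop :=
  IsSVT n lam t ∧ ∀ r c, c < lam r → (t r c).card = 1

/-- The weight: `wt n lam t j` is the number of boxes of `t` containing the entry `j`. -/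
def wt (n : ℕ) (lam : ℕ → ℕ) (t : Filling) (j : ℕ) : ℕ :=
  ((Finset.range n ×ˢ Finset.range (lam 0)).filter (fun p => j ∈ t p.1 p.2)).card

/-- The excess: total number of extra entries. -/
def excess (n : ℕ) (lam : ℕ → ℕ) (t : Filling) : ℕ :=
  ∑ p ∈ Finset.range n ×ˢ Finset.range (lam 0), ((t p.1 p.2).card - 1)

/-- Column `c` contains the entry `a`. -/
def colHas (n : ℕ) (t : Filling) (a c : ℕ) : Prop := ∃ r, r < n ∧ a ∈ t r c

/-- The sign of column `c` for the `i`-signature rule: `+` (true) if the column contains `i`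
but not `i+1`, `-` (false) if it contains `i+1` but not `i`. -/
def colSign (n : ℕ) (t : Filling) (i c : ℕ) : Option Bool :=
  if colHas n t i c ∧ ¬ colHas n t (i + 1) c then some true
  else if colHas n t (i + 1) c ∧ ¬ colHas n t i c then some false
  else none

/-- The number of `-` (false) signs left uncanceled after scanning the word left-to-right,
iteratively canceling `-+` pairs. -/
def mctr (w : List Bool) : ℕ := w.foldl (fun cnt b => if b then cnt - 1 else cnt + 1) 0

/-- The number of `+` (true) signs left uncanceled, scanning right-to-left. -/
def pctr (w : List Bool) : ℕ := w.foldr (fun b cnt => if b then cnt + 1 else cnt - 1) 0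

/-- The word of column signs of the columns before column `c`. -/
def colWordBefore (n : ℕ) (t : Filling) (i c : ℕ) : List Bool :=
  (List.range c).filterMap (colSign n t i)

/-- The word of column signs of the columns after column `c` (among columns `< ncols`). -/
def colWordAfter (n ncols : ℕ) (t : Filling) (i c : ℕ) : List Bool :=
  ((List.range ncols).drop (c + 1)).filterMap (colSign n t i)

/-- Column `c` carries an uncanceled `+` for the `i`-signature rule. -/
def PlusCol (n ncols : ℕ) (t : Filling) (i c : ℕ) : Prop :=
  c < ncols ∧ colSign n t i c = some true ∧ mctr (colWordBefore n t i c) = 0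

/-- Column `c` carries an uncanceled `-` for the `i`-signature rule. -/
def MinusCol (n ncols : ℕ) (t : Filling) (i c : ℕ) : Prop :=
  c < ncols ∧ colSign n t i c = some false ∧ pctr (colWordAfter n ncols t i c) = 0

/-- Column `c` is the rightmost uncanceled `+`. -/
def fBoxCol (n ncols : ℕ) (t : Filling) (i c : ℕ) : Prop :=
  PlusCol n ncols t i c ∧ ∀ c', PlusCol n ncols t i c' → c' ≤ c

/-- Column `c` is the leftmost uncanceled `-`. -/
def eBoxCol (n ncols : ℕ) (t : Filling) (i c : ℕ) : Prop :=
  MinusCol n ncols t i c ∧ ∀ c', MinusCol n ncols t i c' → c ≤ c'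

/-- Replace the content of the box in row `r`, column `c` by `A`. -/
def updateBox (t : Filling) (r c : ℕ) (A : Finset ℕ) : Filling :=
  fun r' c' => if r' = r ∧ c' = c then A else t r' c'

/-- The set-valued crystal operator `f_i` (signature rule). -/
def fRaw (n : ℕ) (lam : ℕ → ℕ) (i : ℕ) (t : Filling) : Option Filling :=
  if h : ∃ c, fBoxCol n (lam 0) t i c then
    let c := Classical.choose h
    if hr : ∃ r, r < n ∧ i ∈ t r c then
      let r := Classical.choose hr
      if i ∈ t r (c + 1) then
        some (updateBox (updateBox t r (c + 1) ((t r (c + 1)).erase i)) r c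
          (insert (i + 1) (t r c)))
      else some (updateBox t r c (insert (i + 1) ((t r c).erase i)))
    else none
  else none

/-- The set-valued crystal operator `e_i` (signature rule). -/
def eRaw (n : ℕ) (lam : ℕ → ℕ) (i : ℕ) (t : Filling) : Option Filling :=
  if h : ∃ c, eBoxCol n (lam 0) t i c then
    let c := Classical.choose h
    if hr : ∃ r, r < n ∧ (i + 1) ∈ t r c then
      let r := Classical.choose hr
      if 0 < c ∧ (i + 1) ∈ t r (c - 1) then
        some (updateBox (updateBox t r (c - 1) ((t r (c - 1)).erase (i + 1))) r c
          (insert i (t r c)))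
      else some (updateBox t r c (insert i ((t r c).erase (i + 1))))
    else none
  else none

/-- Iterate a partially-defined operator. -/
def iterOpt (g : Filling → Option Filling) : ℕ → Filling → Option Filling
  | 0, t => some t
  | m + 1, t => (iterOpt g m t).bind g

/-- Highest weight (Yamanouchi) elements. -/
def IsYamanouchi (n : ℕ) (lam : ℕ → ℕ) (t : Filling) : Prop :=
  ∀ i, 1 ≤ i → i < n → eRaw n lam i t = none

/-- Closure of `t0` under the crystal operators `e_i`, `f_i` for `1 ≤ i < n`. -/
inductive Reach (n : ℕ) (lam : ℕ → ℕ) (t0 : Filling) : Filling → Prop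
  | base : Reach n lam t0 t0
  | stepF : ∀ {t t' : Filling} (i : ℕ), 1 ≤ i → i < n → Reach n lam t0 t →
      fRaw n lam i t = some t' → Reach n lam t0 t'
  | stepE : ∀ {t t' : Filling} (i : ℕ), 1 ≤ i → i < n → Reach n lam t0 t →
      eRaw n lam i t = some t' → Reach n lam t0 t'

/-- The one-row partition `(s)`. -/
def rowShape (s : ℕ) : ℕ → ℕ := fun r => if r = 0 then s else 0

/-- The one-column partition `(1^k)`. -/
def colShape (k : ℕ) : ℕ → ℕ := fun r => if r < k then 1 else 0

/-- The hook partition `(s, 1^e)`. -/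
def hookShape (s e : ℕ) : ℕ → ℕ := fun r => if r = 0 then s else if r ≤ e then 1 else 0

/-! ### K-theory crystal operators (for single rows and single columns) -/

/-- Some box of the tableau contains the entry `a`. -/
def containsEntry (n : ℕ) (lam : ℕ → ℕ) (t : Filling) (a : ℕ) : Prop :=
  ∃ r c, r < n ∧ c < lam r ∧ a ∈ t r c

/-- `p` is the rightmost box of `t` containing `i`. -/
def KBoxF (n : ℕ) (lam : ℕ → ℕ) (t : Filling) (i : ℕ) (p : ℕ × ℕ) : Prop :=
  p.1 < n ∧ p.2 < lam p.1 ∧ i ∈ t p.1 p.2 ∧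
    ∀ q : ℕ × ℕ, q.1 < n → q.2 < lam q.1 → i ∈ t q.1 q.2 → q.2 ≤ p.2

/-- The K-crystal operator `f_i^K`: if `i` occurs in `t` and `i+1` does not, add `i+1` to
the rightmost box containing `i`; otherwise `0`. -/
def fK (n : ℕ) (lam : ℕ → ℕ) (i : ℕ) (t : Filling) : Option Filling :=
  if h : (∃ p : ℕ × ℕ, KBoxF n lam t i p) ∧ ¬ containsEntry n lam t (i + 1) then
    let p := Classical.choose h.1
    some (updateBox t p.1 p.2 (insert (i + 1) (t p.1 p.2)))
  else none

/-- The K-crystal operator `e_i^K`: delete `i+1` from the box containing both `i` and `i+1`,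
if such a box exists; otherwise `0`. -/
def eK (n : ℕ) (lam : ℕ → ℕ) (i : ℕ) (t : Filling) : Option Filling :=
  if h : ∃ p : ℕ × ℕ, p.1 < n ∧ p.2 < lam p.1 ∧ i ∈ t p.1 p.2 ∧ (i + 1) ∈ t p.1 p.2 then
    let p := Classical.choose h
    some (updateBox t p.1 p.2 ((t p.1 p.2).erase (i + 1)))
  else none

/-- `t'` is the result of applying `g` to `t` as many times as possible. -/
def MaxApply (g : Filling → Option Filling) (t t' : Filling) : Prop :=
  (∃ m, iterOpt g m t = some t') ∧ g t' = none

/-- One Demazure step: apply `e_i` as many times as possible, then `e_i^K` as many times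
as possible (here `eKop i` is the `i`-th K-operator). -/
def DemStep (n : ℕ) (lam : ℕ → ℕ) (eKop : ℕ → Filling → Option Filling) (i : ℕ)
    (t t' : Filling) : Prop :=
  ∃ t1, MaxApply (eRaw n lam i) t t1 ∧ MaxApply (eKop i) t1 t'

/-- `DemReach n lam eKop [i₁,…,iℓ] t u` holds when
`u = (e_{iℓ}^K)^max e_{iℓ}^max ⋯ (e_{i₁}^K)^max e_{i₁}^max t`. -/
def DemReach (n : ℕ) (lam : ℕ → ℕ) (eKop : ℕ → Filling → Option Filling) :
    List ℕ → Filling → Filling → Prop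
  | [], t, u => t = u
  | i :: rest, t, u => ∃ t2, DemStep n lam eKop i t t2 ∧ DemReach n lam eKop rest t2 u

/-- The minimal highest weight tableau `u_λ`, whose row `r` boxes are all `{r+1}`. -/
def uTab (lam : ℕ → ℕ) : Filling := fun r c => if c < lam r then {r + 1} else ∅

/-- The K-Demazure crystal associated with a word `[i₁,…,iℓ]`. -/
def KDem (n : ℕ) (lam : ℕ → ℕ) (eKop : ℕ → Filling → Option Filling) (word : List ℕ) :
    Set Filling :=
  {t | IsSVT n lam t ∧ DemReach n lam eKop word t (uTab lam)}

/-! ### Permutations and reduced words -/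

/-- The permutation `s_{i₁} ⋯ s_{iℓ}` of a word `[i₁,…,iℓ]`, where `s_i` swaps `i`, `i+1`. -/
def wordPerm (word : List ℕ) : Equiv.Perm ℕ :=
  (word.map fun i => Equiv.swap i (i + 1)).prod

/-- `word` is a reduced word for `w` in the Coxeter generators `s_1, …, s_{n-1}`. -/
def IsReducedWord (n : ℕ) (w : Equiv.Perm ℕ) (word : List ℕ) : Prop :=
  (∀ i ∈ word, 1 ≤ i ∧ i < n) ∧ wordPerm word = w ∧
    ∀ word' : List ℕ, (∀ i ∈ word', 1 ≤ i ∧ i < n) → wordPerm word' = w →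
      word.length ≤ word'.length

/-- The Coxeter length of a permutation of `{1,…,n}`. -/
def permLength (n : ℕ) (σ : Equiv.Perm ℕ) : ℕ :=
  sInf {l | ∃ word : List ℕ, (∀ i ∈ word, 1 ≤ i ∧ i < n) ∧ wordPerm word = σ ∧
    word.length = l}

/-- The parabolic subgroup generated by `s_2, …, s_{n-1}`. -/
def parabolic (n : ℕ) : Subgroup (Equiv.Perm ℕ) :=
  Subgroup.closure {σ | ∃ i, 2 ≤ i ∧ i < n ∧ σ = Equiv.swap i (i + 1)}

/-! ### Polynomials -/

/-- Polynomials in `x₁, x₂, …` over `ℤ[β]`; the variable `β` is `Polynomial.X`. -/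
abbrev KPoly : Type := MvPolynomial ℕ (Polynomial ℤ)

/-- The scalar `β`. -/
def betaP : KPoly := MvPolynomial.C Polynomial.X

/-- The monomial `x^{wt(T)} = x₁^{wt₁} ⋯ xₙ^{wtₙ}`. -/
def xwt (n : ℕ) (lam : ℕ → ℕ) (t : Filling) : KPoly :=
  ∏ j ∈ Finset.Icc 1 n, (MvPolynomial.X j : KPoly) ^ wt n lam t j

/-- The β-character `∑_{T ∈ S} β^{excess T} x^{wt T}` of a set of tableaux. -/
def charSet (n : ℕ) (lam : ℕ → ℕ) (S : Set Filling) : KPoly :=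
  ∑ᶠ t ∈ S, betaP ^ excess n lam t * xwt n lam t

/-- The symmetric Grothendieck polynomial `𝔊_λ(x₁,…,xₙ; β)`. -/
def Groth (n : ℕ) (lam : ℕ → ℕ) : KPoly :=
  charSet n lam {t | IsSVT n lam t}

/-- The Schur polynomial `s_μ(x₁,…,xₙ)`. -/
def SchurP (n : ℕ) (mu : ℕ → ℕ) : KPoly :=
  ∑ᶠ t ∈ {t : Filling | IsSSYT n mu t}, xwt n mu t

/-- The numerator defining the Demazure–Lascoux operator `ϖ_i`. -/
def DLnum (i : ℕ) (f : KPoly) : KPoly :=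
  (MvPolynomial.X i + betaP * MvPolynomial.X i * MvPolynomial.X (i + 1)) * f -
    (MvPolynomial.X (i + 1) + betaP * MvPolynomial.X i * MvPolynomial.X (i + 1)) *
      (MvPolynomial.rename (Equiv.swap i (i + 1)) f)

/-- `DL` implements the Demazure–Lascoux operators `ϖ_i` for `1 ≤ i < n`:
`(x_i - x_{i+1}) · ϖ_i f` equals the defining numerator. -/
def IsDLOp (n : ℕ) (DL : ℕ → KPoly → KPoly) : Prop :=
  ∀ i, 1 ≤ i → i < n → ∀ f : KPoly,
    (MvPolynomial.X i - MvPolynomial.X (i + 1)) * DL i f = DLnum i f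

/-- `applyDL DL [i₁,…,iℓ] f = ϖ_{i₁} ϖ_{i₂} ⋯ ϖ_{iℓ} f`. -/
def applyDL (DL : ℕ → KPoly → KPoly) : List ℕ → KPoly → KPoly
  | [], f => f
  | i :: rest, f => DL i (applyDL DL rest f)

/-- Elements `+^p -^m` of the bicyclic monoid generated by `+` and `-` subject to `- + = 1`. -/
@[ext]
structure Bic where
  /-- The number of uncancelled `+` signs. -/
  p : ℕ
  /-- The number of uncancelled `-` signs. -/
  m : ℕ

namespace Bic

instance : Mul Bic := ⟨fun x y => ⟨x.p + (y.p - x.m), y.m + (x.m - y.p)⟩⟩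

instance : One Bic := ⟨⟨0, 0⟩⟩

theorem mul_p (x y : Bic) : (x * y).p = x.p + (y.p - x.m) := rfl

theorem mul_m (x y : Bic) : (x * y).m = y.m + (x.m - y.p) := rfl

theorem one_p : (1 : Bic).p = 0 := rfl

theorem one_m : (1 : Bic).m = 0 := rfl

instance : Monoid Bic where
  mul_assoc x y z := by ext <;> simp only [mul_p, mul_m] <;> omega
  one_mul x := by ext <;> simp only [mul_p, mul_m, one_p, one_m] <;> omega
  mul_one x := by ext <;> simp only [mul_p, mul_m, one_p, one_m] <;> omega

/-- The sign `+`. -/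
def plus : Bic := ⟨1, 0⟩

/-- The sign `-`. -/
def minus : Bic := ⟨0, 1⟩

theorem plus_p : plus.p = 1 := rfl

theorem plus_m : plus.m = 0 := rfl

theorem minus_p : minus.p = 0 := rfl

theorem minus_m : minus.m = 1 := rfl

theorem minus_mul_plus : minus * plus = 1 := rfl

theorem minus_mul_mul_plus {x : Bic} (hx : x.m = 0) : minus * x * plus = x := by
  ext <;> simp only [mul_p, mul_m, plus_p, plus_m, minus_p, minus_m] <;> omega

theorem prod_m_eq_zero {L : List Bic} (h : ∀ x ∈ L, x.m = 0) : L.prod.m = 0 := by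
  induction L with
  | nil => rfl
  | cons a L ih =>
    rw [List.prod_cons, mul_m, ih fun x hx => h x (List.mem_cons_of_mem _ hx),
      h a List.mem_cons_self]
    omega

end Bic

/-! ### The crystal of words -/

/-- The sign of a letter for the `i`-signature rule. -/
def letter (i x : ℕ) : Bic :=
  if x = i then Bic.plus else if x = i + 1 then Bic.minus else 1

/-- The reduced `i`-signature of a word. -/
def sig (i : ℕ) (w : List ℕ) : Bic := (w.map (letter i)).prod

theorem sig_nil (i : ℕ) : sig i [] = 1 := rfl

theorem sig_cons (i a : ℕ) (w : List ℕ) : sig i (a :: w) = letter i a * sig i w := by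
  simp [sig]

theorem sig_append (i : ℕ) (u v : List ℕ) : sig i (u ++ v) = sig i u * sig i v := by
  simp [sig]

theorem letter_self (i : ℕ) : letter i i = Bic.plus := by simp [letter]

theorem letter_succ (i : ℕ) : letter i (i + 1) = Bic.minus := by simp [letter]

theorem letter_of_ne {i x : ℕ} (h : x ≠ i) (h' : x ≠ i + 1) : letter i x = 1 := by
  simp [letter, h, h']

theorem letter_m_of_le {i x : ℕ} (h : x ≤ i) : (letter i x).m = 0 := by
  unfold letter
  split_ifs
  · rfl
  · omega
  · rfl

theorem sig_p_cons (i a : ℕ) (w : List ℕ) : (sig i (a :: w)).p =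
    if a = i then (sig i w).p + 1 else if a = i + 1 then (sig i w).p - 1 else (sig i w).p := by
  rw [sig_cons, Bic.mul_p]
  unfold letter
  split_ifs <;> simp [Bic.plus, Bic.minus, Bic.one_p, Bic.one_m]; omega

theorem sig_count (i : ℕ) (w : List ℕ) :
    (sig i w).p + w.count (i + 1) = (sig i w).m + w.count i := by
  induction w with
  | nil => rfl
  | cons a w ih =>
    rw [sig_cons, Bic.mul_p, Bic.mul_m, List.count_cons, List.count_cons]
    unfold letter
    simp only [beq_iff_eq]
    split_ifs <;> simp only [Bic.plus, Bic.minus, Bic.one_p, Bic.one_m] <;> omega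

/-- The operator `f_i` on words, as a relation: the letter `i` carrying the rightmost
uncancelled `+` is replaced by `i + 1`. -/
def FStep (i : ℕ) (w w' : List ℕ) : Prop :=
  ∃ u v, w = u ++ i :: v ∧ w' = u ++ (i + 1) :: v ∧ (sig i u).m = 0 ∧ (sig i v).p = 0

theorem FStep.p_pos {i : ℕ} {w w' : List ℕ} (h : FStep i w w') : 0 < (sig i w).p := by
  obtain ⟨u, v, rfl, -, hu, hv⟩ := h
  rw [sig_append, sig_cons, letter_self]
  simp only [Bic.mul_p, Bic.plus_p, Bic.plus_m]
  omega

theorem FStep.m_pos {i : ℕ} {w w' : List ℕ} (h : FStep i w w') : 0 < (sig i w').m := by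
  obtain ⟨u, v, -, rfl, hu, hv⟩ := h
  rw [sig_append, sig_cons, letter_succ]
  simp only [Bic.mul_p, Bic.mul_m, Bic.minus_p, Bic.minus_m]
  omega

theorem FStep.sum_eq {i : ℕ} {w w' : List ℕ} (h : FStep i w w') : w'.sum = w.sum + 1 := by
  obtain ⟨u, v, rfl, rfl, -, -⟩ := h
  simp
  omega

theorem FStep.length_eq {i : ℕ} {w w' : List ℕ} (h : FStep i w w') : w.length = w'.length := by
  obtain ⟨u, v, rfl, rfl, -, -⟩ := h
  simp

theorem fStep_cons {i a : ℕ} {l w' : List ℕ} : FStep i (a :: l) w' ↔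
    (a = i ∧ (sig i l).p = 0 ∧ w' = (i + 1) :: l) ∨
      ∃ l', w' = a :: l' ∧ FStep i l l' ∧ (a = i + 1 → 2 ≤ (sig i l).p) := by
  constructor
  · rintro ⟨u, v, hw, rfl, hu, hv⟩
    cases u with
    | nil =>
      simp only [List.nil_append, List.cons.injEq] at hw
      left
      exact ⟨hw.1, by rw [hw.2]; exact hv, by simp [hw.2]⟩
    | cons b u =>
      simp only [List.cons_append, List.cons.injEq] at hw
      obtain ⟨rfl, rfl⟩ := hw
      right
      rw [sig_cons, Bic.mul_m] at hu
      refine ⟨_, rfl, ⟨u, v, rfl, rfl, by omega, hv⟩, ?_⟩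
      rintro rfl
      rw [letter_succ, Bic.minus_m] at hu
      rw [sig_append, sig_cons, letter_self]
      simp only [Bic.mul_p, Bic.plus_p, Bic.plus_m]
      omega
  · rintro (⟨rfl, hp, rfl⟩ | ⟨l', rfl, ⟨u, v, rfl, rfl, hu, hv⟩, h⟩)
    · exact ⟨[], l, rfl, rfl, rfl, hp⟩
    · refine ⟨a :: u, v, rfl, rfl, ?_, hv⟩
      rw [sig_cons, Bic.mul_m, hu]
      rw [sig_append, sig_cons, letter_self] at h
      simp only [Bic.mul_p, Bic.plus_p, Bic.plus_m] at h
      unfold letter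
      split_ifs with h1 h2
      · simp [Bic.plus_m]
      · have := h h2
        rw [Bic.minus_m]
        omega
      · simp [Bic.one_m]

theorem FStep.right_unique {i : ℕ} {w w₁ w₂ : List ℕ} (h₁ : FStep i w w₁) (h₂ : FStep i w w₂) :
    w₁ = w₂ := by
  induction w generalizing w₁ w₂ with
  | nil => obtain ⟨u, v, h, -⟩ := h₁; simp at h
  | cons a l ih =>
    rw [fStep_cons] at h₁ h₂
    rcases h₁ with ⟨_, hp, rfl⟩ | ⟨l₁, rfl, hl₁, -⟩ <;>
    rcases h₂ with ⟨_, hp', rfl⟩ | ⟨l₂, rfl, hl₂, -⟩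
    · rfl
    · have := hl₂.p_pos; omega
    · have := hl₁.p_pos; omega
    · rw [ih hl₁ hl₂]

theorem FStep.left_unique {i : ℕ} {w w₁ w₂ : List ℕ} (h₁ : FStep i w₁ w) (h₂ : FStep i w₂ w) :
    w₁ = w₂ := by
  obtain ⟨u, v, rfl, rfl, hu, hv⟩ := h₁
  obtain ⟨u', v', rfl, h, hu', hv'⟩ := h₂
  have key : ∀ {u v x y : List ℕ}, (sig i u).m = 0 → (sig i v).p = 0 →
      u = x ++ (i + 1) :: y → (sig i (y ++ (i + 1) :: v)).p = 0 → False := by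
    rintro u v x y hu hv rfl hy
    rw [sig_append, sig_cons, letter_succ] at hu hy
    simp only [Bic.mul_p, Bic.mul_m, Bic.minus_p, Bic.minus_m] at hu hy
    omega
  rw [List.append_eq_append_iff] at h
  rcases h with ⟨x, hx, hx'⟩ | ⟨x, hx, hx'⟩ <;> rcases x with _ | ⟨b, x⟩
  · simp_all
  · simp only [List.cons_append, List.cons.injEq] at hx'
    obtain ⟨rfl, rfl⟩ := hx'
    exact (key hu' hv' hx hv).elim
  · simp_all
  · simp only [List.cons_append, List.cons.injEq] at hx'
    obtain ⟨rfl, rfl⟩ := hx'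
    exact (key hu hv hx hv').elim

/-- Automorphisms of the crystal of words that permute the letters of each word. -/
structure WordAut where
  /-- The underlying bijection. -/
  e : List ℕ ≃ List ℕ
  perm : ∀ w, (e w).Perm w
  p_eq : ∀ i w, (sig i (e w)).p = (sig i w).p
  fStep : ∀ {i w w'}, FStep i w w' → FStep i (e w) (e w')
  fStep_symm : ∀ {i w w'}, FStep i w w' → FStep i (e.symm w) (e.symm w')

namespace WordAut

theorem count_eq (Φ : WordAut) (w : List ℕ) (j : ℕ) : (Φ.e w).count j = w.count j :=
  (Φ.perm w).count_eq j

theorem m_eq (Φ : WordAut) (i : ℕ) (w : List ℕ) : (sig i (Φ.e w)).m = (sig i w).m := by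
  have h1 := sig_count i (Φ.e w)
  have h2 := sig_count i w
  rw [Φ.p_eq, Φ.count_eq, Φ.count_eq] at h1
  omega

/-- The identity automorphism. -/
def refl : WordAut where
  e := Equiv.refl _
  perm w := List.Perm.refl w
  p_eq _ _ := rfl
  fStep h := h
  fStep_symm h := h

/-- The inverse automorphism. -/
def symm (Φ : WordAut) : WordAut where
  e := Φ.e.symm
  perm w := by simpa using (Φ.perm (Φ.e.symm w)).symm
  p_eq i w := by simpa using (Φ.p_eq i (Φ.e.symm w)).symm
  fStep h := Φ.fStep_symm h
  fStep_symm h := Φ.fStep h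

/-- The composite of two automorphisms. -/
def trans (Φ Ψ : WordAut) : WordAut where
  e := Φ.e.trans Ψ.e
  perm w := (Ψ.perm _).trans (Φ.perm w)
  p_eq i w := (Ψ.p_eq i _).trans (Φ.p_eq i w)
  fStep h := Ψ.fStep (Φ.fStep h)
  fStep_symm h := Φ.fStep_symm (Ψ.fStep_symm h)

/-- Apply a map to the tail of a word. -/
def onTail (g : List ℕ → List ℕ) : List ℕ → List ℕ
  | [] => []
  | a :: l => a :: g l

theorem onTail_fStep {g : List ℕ → List ℕ} (hp : ∀ i w, (sig i (g w)).p = (sig i w).p)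
    (hg : ∀ {i w w'}, FStep i w w' → FStep i (g w) (g w')) {i : ℕ} {w w' : List ℕ}
    (h : FStep i w w') : FStep i (onTail g w) (onTail g w') := by
  cases w with
  | nil => obtain ⟨u, v, h, -⟩ := h; simp at h
  | cons a l =>
    rw [fStep_cons] at h
    rcases h with ⟨rfl, h, rfl⟩ | ⟨l', rfl, h, h'⟩
    · exact fStep_cons.2 (.inl ⟨rfl, by rw [hp, h], rfl⟩)
    · exact fStep_cons.2 (.inr ⟨_, rfl, hg h, by rwa [hp]⟩)

/-- An automorphism acting on the tail of a word. -/
def tail (Φ : WordAut) : WordAut where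
  e :=
    { toFun := onTail Φ.e
      invFun := onTail Φ.e.symm
      left_inv := fun w => by cases w <;> simp [onTail]
      right_inv := fun w => by cases w <;> simp [onTail] }
  perm w := by
    cases w with
    | nil => exact List.Perm.refl _
    | cons a l => exact (Φ.perm l).cons a
  p_eq i w := by
    cases w with
    | nil => rfl
    | cons a l => simp only [Equiv.coe_fn_mk, onTail, sig_p_cons, Φ.p_eq]
  fStep h := onTail_fStep Φ.p_eq Φ.fStep h
  fStep_symm h := onTail_fStep Φ.symm.p_eq Φ.fStep_symm h

/-- The elementary Knuth move on the first three letters of a word, extended by the identity. -/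
def knuth : List ℕ → List ℕ
  | a :: b :: c :: l =>
    if (a ≤ c ∧ c < b) ∨ (b ≤ c ∧ c < a) then b :: a :: c :: l
    else if (b < a ∧ a ≤ c) ∨ (c < a ∧ a ≤ b) then a :: c :: b :: l
    else a :: b :: c :: l
  | l => l

theorem knuth_knuth (w : List ℕ) : knuth (knuth w) = w := by
  match w with
  | [] => rfl
  | [_] => rfl
  | [_, _] => rfl
  | a :: b :: c :: l =>
    simp only [knuth]
    split_ifs with h1 h2 <;> (try dsimp only) <;> split_ifs <;> first | rfl | omega

theorem knuth_perm (w : List ℕ) : (knuth w).Perm w := by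
  match w with
  | [] => rfl
  | [_] => rfl
  | [_, _] => rfl
  | a :: b :: c :: l =>
    simp only [knuth]
    split_ifs with h1 h2
    · exact List.Perm.swap _ _ _
    · exact (List.Perm.swap _ _ _).cons a
    · rfl

theorem knuth_p_eq (i : ℕ) (w : List ℕ) : (sig i (knuth w)).p = (sig i w).p := by
  match w with
  | [] => rfl
  | [_] => rfl
  | [_, _] => rfl
  | a :: b :: c :: l =>
    simp only [knuth]
    split_ifs with h1 h2 <;> simp only [sig_p_cons] <;> grind

theorem knuth_of_length_lt {w : List ℕ} (h : w.length < 3) : knuth w = w := by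
  match w with
  | [] => rfl
  | [_] => rfl
  | [_, _] => rfl
  | _ :: _ :: _ :: _ => simp only [List.length_cons] at h; omega

theorem knuth_fStep {i : ℕ} {w w' : List ℕ} (h : FStep i w w') :
    FStep i (knuth w) (knuth w') := by
  by_cases hw : w.length < 3
  · rwa [knuth_of_length_lt hw, knuth_of_length_lt (h.length_eq ▸ hw)]
  match w with
  | [] => simp at hw
  | [_] => simp at hw
  | [_, _] => simp at hw
  | a :: b :: c :: l =>
    simp only [fStep_cons] at h
    simp only [sig_p_cons] at h
    generalize hp : (sig i l).p = p at h
    rcases h with ⟨rfl, h, rfl⟩ |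
        ⟨_, rfl, ⟨rfl, h, rfl⟩ | ⟨_, rfl, ⟨rfl, h, rfl⟩ | ⟨l', rfl, h, h1⟩, h2⟩, h3⟩ <;>
      simp only [knuth]
    · split_ifs <;> simp only [fStep_cons, sig_p_cons, hp] <;> grind
    · split_ifs <;> simp only [fStep_cons, sig_p_cons, hp] <;> grind
    · split_ifs <;> simp only [fStep_cons, sig_p_cons, hp] <;> grind
    · have := h.p_pos
      split_ifs <;> simp only [fStep_cons, sig_p_cons, hp] <;> grind

/-- The automorphism given by the elementary Knuth move on the first three letters. -/
def knuthAut : WordAut where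
  e := ⟨knuth, knuth, knuth_knuth, knuth_knuth⟩
  perm := knuth_perm
  p_eq := knuth_p_eq
  fStep := knuth_fStep
  fStep_symm := knuth_fStep

end WordAut

/-- Two words are equivalent if an automorphism of the crystal of words relates them. -/
def WordEquiv (w w' : List ℕ) : Prop := ∃ Φ : WordAut, Φ.e w = w'

namespace WordEquiv

theorem refl (w : List ℕ) : WordEquiv w w := ⟨WordAut.refl, rfl⟩

theorem symm {w w' : List ℕ} : WordEquiv w w' → WordEquiv w' w := by
  rintro ⟨Φ, rfl⟩
  exact ⟨Φ.symm, Φ.e.symm_apply_apply w⟩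

theorem trans {u v w : List ℕ} : WordEquiv u v → WordEquiv v w → WordEquiv u w := by
  rintro ⟨Φ, rfl⟩ ⟨Ψ, rfl⟩
  exact ⟨Φ.trans Ψ, rfl⟩

theorem cons (a : ℕ) {w w' : List ℕ} : WordEquiv w w' → WordEquiv (a :: w) (a :: w') := by
  rintro ⟨Φ, rfl⟩
  exact ⟨Φ.tail, rfl⟩

theorem append_left (u : List ℕ) {w w' : List ℕ} (h : WordEquiv w w') :
    WordEquiv (u ++ w) (u ++ w') := by
  induction u with
  | nil => exact h
  | cons a u ih => exact ih.cons a

theorem knuth (w : List ℕ) : WordEquiv w (WordAut.knuth w) := ⟨WordAut.knuthAut, rfl⟩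

end WordEquiv

/-- The column word `k (k-1) ⋯ 1`. -/
def colWord : ℕ → List ℕ
  | 0 => []
  | k + 1 => (k + 1) :: colWord k

theorem cons_cons_colWord {y z m : ℕ} (hy : m < y) (hz : y ≤ z) (l : List ℕ) :
    WordEquiv (y :: z :: (colWord m ++ l)) (y :: (colWord m ++ z :: l)) := by
  induction m generalizing y with
  | zero => exact WordEquiv.refl _
  | succ j ih =>
    have h := WordEquiv.knuth (y :: z :: (j + 1) :: (colWord j ++ l))
    rw [WordAut.knuth, if_neg (by omega), if_pos (by omega)] at h
    exact h.trans ((ih (Nat.lt_succ_self j) (by omega)).cons y)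

theorem cons_colWord_append {a k : ℕ} (ha : 1 ≤ a) (hk : a ≤ k) (l : List ℕ) :
    WordEquiv (a :: (colWord k ++ l)) (colWord k ++ a :: l) := by
  induction k with
  | zero => omega
  | succ m ih =>
    rcases hk.lt_or_eq with h | rfl
    · have h1 := WordEquiv.knuth (a :: (m + 1) :: (colWord m ++ l))
      obtain ⟨j, rfl⟩ : ∃ j, m = j + 1 := ⟨m - 1, by omega⟩
      rw [colWord, List.cons_append, WordAut.knuth, if_pos (by omega)] at h1
      exact h1.trans ((ih (by omega)).cons _)
    · exact cons_cons_colWord (Nat.lt_succ_self m) le_rfl l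

theorem sig_colWord {i : ℕ} (hi : 1 ≤ i) (k : ℕ) :
    sig i (colWord k) = if k = i then Bic.plus else 1 := by
  induction k with
  | zero => rw [if_neg (by omega)]; rfl
  | succ k ih =>
    rw [colWord, sig_cons, ih]
    unfold letter
    split_ifs <;> first | omega | rfl

theorem sig_flatMap_colWord {i : ℕ} (hi : 1 ≤ i) (L : List ℕ) :
    sig i (L.flatMap colWord) = ⟨L.count i, 0⟩ := by
  induction L with
  | nil => rfl
  | cons k L ih =>
    rw [List.flatMap_cons, sig_append, ih, sig_colWord hi, List.count_cons]
    simp only [beq_iff_eq]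
    split_ifs
    · ext
      · simp only [Bic.mul_p, Bic.plus_p, Bic.plus_m]; omega
      · simp [Bic.mul_m, Bic.plus_m]
    · rw [one_mul]; rfl

/-- Yamanouchi words. -/
def YamWord (w : List ℕ) : Prop := (∀ x ∈ w, 1 ≤ x) ∧ ∀ i, 1 ≤ i → (sig i w).m = 0

theorem cons_flatMap_colWord {a : ℕ} (ha : 1 ≤ a) {L : List ℕ} (hL : L.Pairwise (· ≥ ·))
    (hpos : ∀ k ∈ L, 1 ≤ k) (hmem : a = 1 ∨ a - 1 ∈ L) :
    ∃ L' : List ℕ, L'.Pairwise (· ≥ ·) ∧ (∀ k ∈ L', 1 ≤ k) ∧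
      (∀ B, a ≤ B → (∀ k ∈ L, k ≤ B) → ∀ k ∈ L', k ≤ B) ∧
      WordEquiv (a :: L.flatMap colWord) (L'.flatMap colWord) := by
  induction L with
  | nil =>
    obtain rfl : a = 1 := by simpa using hmem
    exact ⟨[1], by simp, by simp, by simp, WordEquiv.refl _⟩
  | cons k L ih =>
    rw [List.pairwise_cons] at hL
    by_cases hk : a ≤ k
    · have hmem' : a = 1 ∨ a - 1 ∈ L := by
        rcases hmem with h | h
        · exact .inl h
        · rcases List.mem_cons.1 h with h | h
          · omega
          · exact .inr h
      obtain ⟨L', h1, h2, h3, h4⟩ := ih hL.2 (fun x hx => hpos x (List.mem_cons_of_mem _ hx)) hmem'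
      refine ⟨k :: L', List.pairwise_cons.2 ⟨h3 k hk hL.1, h1⟩, ?_, ?_, ?_⟩
      · rintro x hx
        rcases List.mem_cons.1 hx with rfl | hx
        · omega
        · exact h2 x hx
      · intro B hB hB' x hx
        rcases List.mem_cons.1 hx with rfl | hx
        · exact hB' _ List.mem_cons_self
        · exact h3 B hB (fun y hy => hB' y (List.mem_cons_of_mem _ hy)) x hx
      · exact (cons_colWord_append ha hk _).trans (h4.append_left _)
    · have hk1 := hpos k List.mem_cons_self
      have hak : a = k + 1 := by
        rcases hmem with h | h
        · omega
        · rcases List.mem_cons.1 h with h | h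
          · omega
          · have := hL.1 _ h
            omega
      subst hak
      refine ⟨(k + 1) :: L, List.pairwise_cons.2 ⟨fun x hx => ?_, hL.2⟩, ?_, ?_,
        WordEquiv.refl _⟩
      · have := hL.1 x hx
        omega
      · intro x hx
        rcases List.mem_cons.1 hx with rfl | hx
        · omega
        · exact hpos x (List.mem_cons_of_mem _ hx)
      · intro B hB hB' x hx
        rcases List.mem_cons.1 hx with rfl | hx
        · exact hB
        · exact hB' x (List.mem_cons_of_mem _ hx)

theorem YamWord.exists_canonical {w : List ℕ} (hw : YamWord w) :
    ∃ L : List ℕ, L.Pairwise (· ≥ ·) ∧ (∀ k ∈ L, 1 ≤ k) ∧ WordEquiv w (L.flatMap colWord) := by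
  induction w with
  | nil => exact ⟨[], by simp, by simp, WordEquiv.refl _⟩
  | cons a w ih =>
    have hm : ∀ i, 1 ≤ i → (sig i w).m = 0 := by
      intro i hi
      have := hw.2 i hi
      rw [sig_cons, Bic.mul_m] at this
      omega
    obtain ⟨L, h1, h2, h3⟩ := ih ⟨fun x hx => hw.1 x (List.mem_cons_of_mem _ hx), hm⟩
    have ha := hw.1 a List.mem_cons_self
    have hmem : a = 1 ∨ a - 1 ∈ L := by
      by_cases h : a = 1
      · exact .inl h
      right
      have := hw.2 (a - 1) (by omega)
      obtain ⟨Φ, hΦ⟩ := h3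
      rw [sig_cons, Bic.mul_m, ← Φ.p_eq, hΦ, sig_flatMap_colWord (by omega)] at this
      have h' : letter (a - 1) a = Bic.minus := by
        conv_lhs => rw [show a = a - 1 + 1 by omega]
        exact letter_succ _
      rw [h', Bic.minus_m] at this
      exact List.count_pos_iff.1 (by simp only at this; omega)
    obtain ⟨L', h4, h5, -, h6⟩ := cons_flatMap_colWord ha h1 h2 hmem
    exact ⟨L', h4, h5, (h3.cons a).trans h6⟩

/-- Yamanouchi words of the same weight are equivalent. -/
theorem YamWord.wordEquiv {w w' : List ℕ} (hw : YamWord w) (hw' : YamWord w')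
    (h : ∀ j, w.count j = w'.count j) : WordEquiv w w' := by
  obtain ⟨L, h1, h2, h3⟩ := hw.exists_canonical
  obtain ⟨L', h1', h2', h3'⟩ := hw'.exists_canonical
  suffices L = L' by
    subst this
    exact h3.trans h3'.symm
  refine List.Perm.eq_of_pairwise (fun a b _ _ hab hba => le_antisymm hba hab) h1 h1' ?_
  rw [List.perm_iff_count]
  intro i
  rcases Nat.eq_zero_or_pos i with rfl | hi
  · rw [List.count_eq_zero.2 fun h => by simpa using h2 0 h,
      List.count_eq_zero.2 fun h => by simpa using h2' 0 h]
  · obtain ⟨Φ, hΦ⟩ := h3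
    obtain ⟨Ψ, hΨ⟩ := h3'
    have e1 : L.count i = (sig i w).p := by rw [← Φ.p_eq, hΦ, sig_flatMap_colWord hi]
    have e2 : L'.count i = (sig i w').p := by rw [← Ψ.p_eq, hΨ, sig_flatMap_colWord hi]
    have s1 := sig_count i w
    have s2 := sig_count i w'
    rw [hw.2 i hi, h, h] at s1
    rw [hw'.2 i hi] at s2
    omega

/-! ### Reading words of set-valued tableaux -/

namespace IsSVT

variable {n : ℕ} {lam : ℕ → ℕ} {t : Filling}

theorem lt_of_mem (ht : IsSVT n lam t) {r c a : ℕ} (ha : a ∈ t r c) : c < lam r := by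
  by_contra h
  simp [ht.emptyOutside r c h] at ha

theorem le_of_mem (ht : IsSVT n lam t) {r c c' a x : ℕ} (hc : c < c') (ha : a ∈ t r c)
    (hx : x ∈ t r c') : a ≤ x := by
  induction c', hc using Nat.le_induction generalizing x with
  | base => exact ht.rowWeak r c a x ha hx
  | succ d hd ih =>
    obtain ⟨y, hy⟩ := ht.boxNonempty r d (by have := ht.lt_of_mem hx; omega)
    exact (ih hy).trans (ht.rowWeak r d y x hy hx)

theorem lt_of_mem_col (ht : IsSVT n lam t) (hlam : Antitone lam) {r r' c a x : ℕ} (hr : r < r')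
    (ha : a ∈ t r c) (hx : x ∈ t r' c) : a < x := by
  induction r', hr using Nat.le_induction generalizing x with
  | base => exact ht.colStrict r c a x ha hx
  | succ d hd ih =>
    obtain ⟨y, hy⟩ := ht.boxNonempty d c ((ht.lt_of_mem hx).trans_le (hlam (Nat.le_succ d)))
    exact (ih hy).trans (ht.colStrict d c y x hy hx)

theorem lt_of_mem_of_le (ht : IsSVT n lam t) (hlam : Antitone lam) {r r' c c' a x : ℕ}
    (hr : r < r') (hc : c ≤ c') (ha : a ∈ t r c) (hx : x ∈ t r' c') : a < x := by
  obtain ⟨y, hy⟩ := ht.boxNonempty r c' ((ht.lt_of_mem hx).trans_le (hlam hr.le))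
  have h := ht.lt_of_mem_col hlam hr hy hx
  rcases hc.eq_or_lt with rfl | hc
  · exact ht.lt_of_mem_col hlam hr ha hx
  · exact (ht.le_of_mem hc ha hy).trans_lt h

end IsSVT

/-- The smallest entry of a box. -/
def boxMin (t : Filling) (r c : ℕ) : ℕ := sInf (t r c : Set ℕ)

theorem boxMin_mem {t : Filling} {r c : ℕ} (h : (t r c).Nonempty) : boxMin t r c ∈ t r c :=
  Finset.mem_coe.1 (Nat.sInf_mem (by simpa using h))

theorem boxMin_le {t : Filling} {r c a : ℕ} (h : a ∈ t r c) : boxMin t r c ≤ a :=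
  Nat.sInf_le (Finset.mem_coe.2 h)

theorem boxMin_eq {t : Filling} {r c a : ℕ} (h : a ∈ t r c) (h' : ∀ x ∈ t r c, a ≤ x) :
    boxMin t r c = a :=
  le_antisymm (boxMin_le h) (h' _ (boxMin_mem ⟨a, h⟩))

/-- The contribution of a box to the `i`-signature. -/
def cellSig (t : Filling) (i r c : ℕ) : Bic :=
  (if i + 1 ∈ t r c then Bic.minus else 1) * (if i ∈ t r c then Bic.plus else 1)

/-- The contribution of a list of boxes in a row to the `i`-signature. -/
def rowSig (t : Filling) (i r : ℕ) (L : List ℕ) : Bic := (L.map (cellSig t i r)).prod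

/-- The contribution of a column to the `i`-signature. -/
def colBic (n : ℕ) (t : Filling) (i c : ℕ) : Bic :=
  (if colHas n t (i + 1) c then Bic.minus else 1) * (if colHas n t i c then Bic.plus else 1)

theorem cellSig_eq_one {t : Filling} {i r c : ℕ} (h : i ∉ t r c) (h' : i + 1 ∉ t r c) :
    cellSig t i r c = 1 := by
  simp [cellSig, h, h']

theorem cellSig_eq_one_of_mem {t : Filling} {i r c : ℕ} (h : i ∈ t r c) (h' : i + 1 ∈ t r c) :
    cellSig t i r c = 1 := by
  simp [cellSig, h, h', Bic.minus_mul_plus]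

theorem cellSig_m {t : Filling} {i r c : ℕ} (h : i + 1 ∉ t r c) : (cellSig t i r c).m = 0 := by
  by_cases hi : i ∈ t r c
  · simp [cellSig, h, hi, Bic.plus_m]
  · simp [cellSig, h, hi, Bic.one_m]

theorem rowSig_nil (t : Filling) (i r : ℕ) : rowSig t i r [] = 1 := rfl

theorem rowSig_append (t : Filling) (i r : ℕ) (L L' : List ℕ) :
    rowSig t i r (L ++ L') = rowSig t i r L * rowSig t i r L' := by
  simp [rowSig]

theorem rowSig_singleton (t : Filling) (i r c : ℕ) : rowSig t i r [c] = cellSig t i r c := by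
  simp [rowSig]

theorem rowSig_cons (t : Filling) (i r c : ℕ) (L : List ℕ) :
    rowSig t i r (c :: L) = cellSig t i r c * rowSig t i r L := by
  simp [rowSig]

theorem rowSig_eq_one {t : Filling} {i r : ℕ} {L : List ℕ}
    (h : ∀ c ∈ L, i ∉ t r c ∧ i + 1 ∉ t r c) : rowSig t i r L = 1 :=
  List.prod_eq_one (by
    simp only [List.mem_map]
    rintro _ ⟨c, hc, rfl⟩
    exact cellSig_eq_one (h c hc).1 (h c hc).2)

theorem rowSig_m {t : Filling} {i r : ℕ} {L : List ℕ} (h : ∀ c ∈ L, i + 1 ∉ t r c) :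
    (rowSig t i r L).m = 0 :=
  Bic.prod_m_eq_zero (by
    simp only [List.mem_map]
    rintro _ ⟨c, hc, rfl⟩
    exact cellSig_m (h c hc))

theorem reverse_range_succ (k : ℕ) :
    (List.range (k + 1)).reverse = k :: (List.range k).reverse := by
  simp [List.range_succ]

theorem range_split {c m : ℕ} (h : c < m) :
    List.range m = List.range c ++ c :: List.range' (c + 1) (m - (c + 1)) := by
  rw [List.range_eq_range', List.range_eq_range', ← List.range'_succ]
  have := List.range'_append (s := 0) (m := c) (n := m - (c + 1) + 1) (step := 1)
  rw [one_mul, zero_add] at this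
  rw [this]
  congr 1
  omega

theorem reverse_range_split {r m : ℕ} (h : r < m) :
    (List.range m).reverse =
      (List.range' (r + 1) (m - (r + 1))).reverse ++ r :: (List.range r).reverse := by
  rw [range_split h]
  simp

theorem prod_rowSig_mul_cellSig {n : ℕ} {lam : ℕ → ℕ} {t : Filling} (ht : IsSVT n lam t)
    (hlam : Antitone lam) {L : List ℕ} {b : ℕ} (hL : ∀ c ∈ L, c < b) (i k : ℕ) :
    ((List.range k).reverse.map fun r => rowSig t i r L * cellSig t i r b).prod =
      ((List.range k).reverse.map fun r => rowSig t i r L).prod * colBic k t i b := by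
  induction k with
  | zero => simp [colBic, colHas]
  | succ k ih =>
    rw [reverse_range_succ, List.map_cons, List.map_cons, List.prod_cons, List.prod_cons, ih]
    have hsucc : ∀ a, colHas (k + 1) t a b ↔ a ∈ t k b ∨ colHas k t a b := by
      intro a
      constructor
      · rintro ⟨r, hr, ha⟩
        rcases Nat.lt_succ_iff_lt_or_eq.1 hr with h | rfl
        · exact .inr ⟨r, h, ha⟩
        · exact .inl ha
      · rintro (h | ⟨r, hr, ha⟩)
        · exact ⟨k, Nat.lt_succ_self k, h⟩
        · exact ⟨r, hr.trans (Nat.lt_succ_self k), ha⟩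
    have hcol : ∀ {x a}, x ∈ t k b → colHas k t a b → a < x := by
      rintro x a hx ⟨r, hr, ha⟩
      exact ht.lt_of_mem_col hlam hr ha hx
    have hone : ∀ {x}, x ∈ t k b → x ≤ i + 1 → ¬ colHas k t i b →
        ((List.range k).reverse.map fun r => rowSig t i r L).prod = 1 := by
      intro x hx hxi hn
      refine List.prod_eq_one ?_
      simp only [List.mem_map, List.mem_reverse, List.mem_range]
      rintro _ ⟨r, hr, rfl⟩
      refine rowSig_eq_one fun c hc => ⟨fun h => ?_, fun h => ?_⟩
      · obtain ⟨y, hy⟩ := ht.boxNonempty r b ((ht.lt_of_mem hx).trans_le (hlam hr.le))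
        have h1 := ht.le_of_mem (hL c hc) h hy
        have h2 := ht.lt_of_mem_col hlam hr hy hx
        obtain rfl : y = i := by omega
        exact hn ⟨r, hr, hy⟩
      · have := ht.lt_of_mem_of_le hlam hr (hL c hc).le h hx
        omega
    by_cases h0 : i ∈ t k b
    · have h1 : ¬ colHas k t i b := fun h => (hcol h0 h).false
      have h2 : ¬ colHas k t (i + 1) b := fun h => by have := hcol h0 h; omega
      rw [hone h0 (by omega) h1]
      simp only [colBic, cellSig, hsucc, h0, h1, h2, or_false, if_true, if_false, mul_one]
    · by_cases h3 : i + 1 ∈ t k b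
      · have h2 : ¬ colHas k t (i + 1) b := fun h => (hcol h3 h).false
        by_cases h1 : colHas k t i b
        · simp only [colBic, cellSig, hsucc, h0, h1, h2, h3, true_or, or_true, if_true, if_false,
            mul_one, one_mul, Bic.minus_mul_plus]
          rw [mul_assoc, ← mul_assoc Bic.minus, Bic.minus_mul_mul_plus]
          refine Bic.prod_m_eq_zero ?_
          simp only [List.mem_map, List.mem_reverse, List.mem_range]
          rintro _ ⟨r, hr, rfl⟩
          refine rowSig_m fun c hc h => ?_
          have := ht.lt_of_mem_of_le hlam hr (hL c hc).le h h3
          omega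
        · rw [hone h3 le_rfl h1]
          simp only [colBic, cellSig, hsucc, h0, h1, h2, h3, or_false, if_true, if_false, mul_one]
      · simp only [colBic, cellSig, hsucc, h0, h3, false_or, if_false, mul_one, mul_assoc]

/-- The signatures computed by rows (from bottom to top) and by columns (from left to right)
agree on each interval of columns. -/
theorem prod_rowSig_eq_prod_colBic {n : ℕ} {lam : ℕ → ℕ} {t : Filling} (ht : IsSVT n lam t)
    (hlam : Antitone lam) (i a len : ℕ) :
    ((List.range n).reverse.map fun r => rowSig t i r (List.range' a len)).prod =
      ((List.range' a len).map (colBic n t i)).prod := by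
  induction len with
  | zero =>
    simp [rowSig_nil]
  | succ len ih =>
    simp only [List.range'_1_concat, rowSig_append, rowSig_singleton, List.map_append,
      List.prod_append, List.map_cons, List.map_nil, List.prod_cons, List.prod_nil, mul_one]
    rw [prod_rowSig_mul_cellSig ht hlam, ih]
    intro c hc
    simp only [List.mem_range'_1] at hc
    omega

/-- The entry `x` is a non-minimal entry of one of the first `k` boxes of row `r`. -/
def IsExtra (t : Filling) (r k x : ℕ) : Prop := ∃ c < k, x ∈ t r c ∧ boxMin t r c < x

/-- The reading word of a row: the non-minimal entries in decreasing order, followed by the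
minimal entries of the boxes from left to right. -/
def rowWord (n : ℕ) (lam : ℕ → ℕ) (t : Filling) (r : ℕ) : List ℕ :=
  (List.range (n + 1)).reverse.filter (fun x => IsExtra t r (lam r) x) ++
    (List.range (lam r)).map (boxMin t r)

/-- The reading word of a set-valued tableau: the rows are read from bottom to top. -/
def reading (n : ℕ) (lam : ℕ → ℕ) (t : Filling) : List ℕ :=
  (List.range n).reverse.flatMap (rowWord n lam t)

theorem sig_filter_range (i m : ℕ) (q : ℕ → Prop) :
    sig i ((List.range m).reverse.filter (fun x => q x)) =
      (if i + 1 < m ∧ q (i + 1) then Bic.minus else 1) *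
        (if i < m ∧ q i then Bic.plus else 1) := by
  induction m with
  | zero => simp [sig_nil]
  | succ m ih =>
    rw [reverse_range_succ, List.filter_cons]
    by_cases hq : q m
    · rw [if_pos (by simpa using hq), sig_cons, ih]
      rcases lt_trichotomy m i with h | rfl | h
      · rw [letter_of_ne (by omega) (by omega), if_neg (by omega), if_neg (by omega),
          if_neg (by omega), if_neg (by omega), one_mul]
      · simp [hq, letter_self]
      · by_cases h' : m = i + 1
        · subst h'
          simp [hq, letter_succ]
        · have e1 : i + 1 < m := by omega
          have e2 : i < m := by omega
          have e3 : i + 1 < m + 1 := by omega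
          have e4 : i < m + 1 := by omega
          rw [letter_of_ne (by omega) (by omega), one_mul]
          simp only [e1, e2, e3, e4]
    · rw [if_neg (by simpa using hq), ih]
      have e : ∀ x, (x < m + 1 ∧ q x) ↔ (x < m ∧ q x) := by
        intro x
        constructor
        · rintro ⟨h, h'⟩
          rcases Nat.lt_succ_iff_lt_or_eq.1 h with h | rfl
          · exact ⟨h, h'⟩
          · exact (hq h').elim
        · rintro ⟨h, h'⟩
          exact ⟨by omega, h'⟩
      simp only [e]

theorem isExtra_succ {t : Filling} {r k x : ℕ} :
    IsExtra t r (k + 1) x ↔ IsExtra t r k x ∨ (x ∈ t r k ∧ boxMin t r k < x) := by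
  constructor
  · rintro ⟨c, hc, h⟩
    rcases Nat.lt_succ_iff_lt_or_eq.1 hc with hc | rfl
    · exact .inl ⟨c, hc, h⟩
    · exact .inr h
  · rintro (⟨c, hc, h⟩ | h)
    · exact ⟨c, by omega, h⟩
    · exact ⟨k, by omega, h⟩

theorem IsSVT.le_boxMin {n : ℕ} {lam : ℕ → ℕ} {t : Filling} (ht : IsSVT n lam t) {r c c' a : ℕ}
    (ha : a ∈ t r c) (hc : c < c') (hc' : c' < lam r) : a ≤ boxMin t r c' :=
  ht.le_of_mem hc ha (boxMin_mem (ht.boxNonempty r c' hc'))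

theorem IsSVT.sig_extra_mul_sig_min {n : ℕ} {lam : ℕ → ℕ} {t : Filling} (ht : IsSVT n lam t)
    (i r : ℕ) {k : ℕ} (hk : k ≤ lam r) :
    (if IsExtra t r k (i + 1) then Bic.minus else 1) *
        (if IsExtra t r k i then Bic.plus else 1) *
          sig i ((List.range k).map (boxMin t r)) = rowSig t i r (List.range k) := by
  induction k with
  | zero => simp [IsExtra, sig_nil, rowSig_nil]
  | succ k ih =>
    have ih := ih (by omega)
    have hmin := boxMin_mem (ht.boxNonempty r k (by omega))
    have hle : ∀ {c a}, c < k → a ∈ t r c → a ≤ boxMin t r k := fun hc ha =>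
      ht.le_boxMin ha hc (by omega)
    rw [List.range_succ, List.map_append, sig_append, rowSig_append, ← ih, rowSig_singleton,
      List.map_singleton, sig_cons, sig_nil, mul_one]
    simp only [isExtra_succ]
    have hex : ∀ {x}, boxMin t r k < x → ¬ IsExtra t r k x := by
      rintro x hx ⟨c, hc, hxc, -⟩
      have := hle hc hxc
      omega
    have hone : boxMin t r k < i → sig i ((List.range k).map (boxMin t r)) = 1 := by
      intro h
      refine List.prod_eq_one ?_
      simp only [List.mem_map, List.mem_range]
      rintro _ ⟨_, ⟨c, hc, rfl⟩, rfl⟩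
      have := hle hc (boxMin_mem (ht.boxNonempty r c (by omega)))
      exact letter_of_ne (by omega) (by omega)
    have hmz : boxMin t r k ≤ i → (sig i ((List.range k).map (boxMin t r))).m = 0 := by
      intro h
      refine Bic.prod_m_eq_zero ?_
      simp only [List.mem_map, List.mem_range]
      rintro _ ⟨_, ⟨c, hc, rfl⟩, rfl⟩
      have := hle hc (boxMin_mem (ht.boxNonempty r c (by omega)))
      exact letter_m_of_le (by omega)
    rcases lt_trichotomy (boxMin t r k) i with h | h | h
    · rw [hone h, letter_of_ne (by omega) (by omega), cellSig]
      have h1 := hex h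
      have h2 := hex (show boxMin t r k < i + 1 by omega)
      simp only [h1, h2, h, show boxMin t r k < i + 1 by omega, false_or, and_true, if_false,
        one_mul, mul_one]
    · have h2 := hex (show boxMin t r k < i + 1 by omega)
      have h3 : i ∈ t r k := h ▸ hmin
      have h4 := hmz h.le
      simp only [cellSig, h, h2, h3, show i < i + 1 by omega, false_or, and_true, if_true,
        if_false, one_mul, letter_self, lt_irrefl, and_false, or_false]
      by_cases h5 : i + 1 ∈ t r k
      · simp only [h5, if_true, Bic.minus_mul_plus, mul_one, mul_assoc]
        rw [← mul_assoc, ← mul_assoc, mul_assoc Bic.minus, Bic.minus_mul_mul_plus]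
        split_ifs <;> simp [Bic.mul_m, h4, Bic.plus_m]
      · simp only [h5, if_false, one_mul, mul_assoc]
    · have h3 : i ∉ t r k := fun hi => by have := boxMin_le hi; omega
      have h5 : ¬ boxMin t r k < i + 1 := by omega
      have h6 : letter i (boxMin t r k) = if i + 1 ∈ t r k then Bic.minus else 1 := by
        by_cases h7 : i + 1 ∈ t r k
        · have := boxMin_le h7
          rw [show boxMin t r k = i + 1 by omega, if_pos h7, letter_succ]
        · have : boxMin t r k ≠ i + 1 := fun h => h7 (h ▸ hmin)
          rw [if_neg h7, letter_of_ne (by omega) this]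
      simp only [cellSig, h3, h5, h6, and_false, false_and, or_false, if_false, mul_one, mul_assoc]

theorem IsSVT.sig_rowWord {n : ℕ} {lam : ℕ → ℕ} {t : Filling} (ht : IsSVT n lam t) (i r : ℕ) :
    sig i (rowWord n lam t r) = rowSig t i r (List.range (lam r)) := by
  have hb : ∀ x, (x < n + 1 ∧ IsExtra t r (lam r) x) ↔ IsExtra t r (lam r) x := by
    refine fun x => and_iff_right_of_imp ?_
    rintro ⟨c, -, hx, -⟩
    have := (ht.entryBounds r c x hx).2
    omega
  rw [rowWord, sig_append, sig_filter_range, ← ht.sig_extra_mul_sig_min i r le_rfl]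
  simp only [hb]

theorem rowSig_range_eq {n : ℕ} {lam : ℕ → ℕ} {t : Filling} (ht : IsSVT n lam t)
    (hlam : Antitone lam) (i r : ℕ) :
    rowSig t i r (List.range (lam r)) = rowSig t i r (List.range (lam 0)) := by
  obtain ⟨d, hd⟩ := Nat.exists_eq_add_of_le (hlam (Nat.zero_le r))
  rw [hd, List.range_add, rowSig_append, rowSig_eq_one (L := List.map _ _), mul_one]
  intro c hc
  simp only [List.mem_map, List.mem_range] at hc
  obtain ⟨a, -, rfl⟩ := hc
  simp [ht.emptyOutside r (lam r + a) (by omega)]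

theorem IsSVT.sig_flatMap_rowWord {n : ℕ} {lam : ℕ → ℕ} {t : Filling} (ht : IsSVT n lam t)
    (hlam : Antitone lam) (i : ℕ) (L : List ℕ) :
    sig i (L.flatMap (rowWord n lam t)) =
      (L.map fun r => rowSig t i r (List.range (lam 0))).prod := by
  induction L with
  | nil => rfl
  | cons r L ih =>
    rw [List.flatMap_cons, sig_append, ih, ht.sig_rowWord, rowSig_range_eq ht hlam,
      List.map_cons, List.prod_cons]

theorem IsSVT.sig_reading {n : ℕ} {lam : ℕ → ℕ} {t : Filling} (ht : IsSVT n lam t)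
    (hlam : Antitone lam) (i : ℕ) :
    sig i (reading n lam t) = ((List.range (lam 0)).map (colBic n t i)).prod := by
  rw [reading, ht.sig_flatMap_rowWord hlam, List.range_eq_range' (n := lam 0),
    prod_rowSig_eq_prod_colBic ht hlam]

theorem updateBox_self (t : Filling) (r c : ℕ) (A : Finset ℕ) : updateBox t r c A r c = A := by
  simp [updateBox]

theorem updateBox_of_row_ne {t : Filling} {r r' c c' : ℕ} {A : Finset ℕ} (h : r' ≠ r) :
    updateBox t r c A r' c' = t r' c' := by
  simp [updateBox, h]

theorem updateBox_of_col_ne {t : Filling} {r r' c c' : ℕ} {A : Finset ℕ} (h : c' ≠ c) :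
    updateBox t r c A r' c' = t r' c' := by
  simp [updateBox, h]

theorem sig_map_boxMin {n : ℕ} {lam : ℕ → ℕ} {t : Filling} (ht : IsSVT n lam t) {i r : ℕ}
    {L : List ℕ} (hL : ∀ d ∈ L, d < lam r ∧ ∀ x ∈ t r d, i < x) :
    sig i (L.map (boxMin t r)) = rowSig t i r L := by
  rw [sig, rowSig, List.map_map]
  congr 1
  refine List.map_congr_left fun d hd => ?_
  obtain ⟨h1, h2⟩ := hL d hd
  have hmin := boxMin_mem (ht.boxNonempty r d h1)
  have hlt := h2 _ hmin
  have hi : i ∉ t r d := fun h => (h2 i h).false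
  simp only [Function.comp_apply, cellSig, hi, if_false, mul_one]
  by_cases h : i + 1 ∈ t r d
  · have := boxMin_le h
    rw [show boxMin t r d = i + 1 by omega, if_pos h, letter_succ]
  · rw [if_neg h]
    refine letter_of_ne (by omega) fun h' => h (h' ▸ hmin)

theorem filter_reverse_range_congr {m : ℕ} {q q' : ℕ → Prop} (h : ∀ x, q' x ↔ q x) :
    (List.range m).reverse.filter (fun x => q' x) =
      (List.range m).reverse.filter (fun x => q x) := by
  simp only [h]

theorem rowWord_congr {n : ℕ} {lam : ℕ → ℕ} {t t' : Filling} {r : ℕ} (h : ∀ c, t' r c = t r c) :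
    rowWord n lam t' r = rowWord n lam t r := by
  have h0 : t' r = t r := funext h
  have h1 : ∀ x, IsExtra t' r (lam r) x ↔ IsExtra t r (lam r) x := by
    intro x
    unfold IsExtra boxMin
    simp only [h0]
  rw [rowWord, rowWord, filter_reverse_range_congr h1]
  congr 1
  exact List.map_congr_left fun d _ => by unfold boxMin; rw [h0]

/-- Replacing `i` by `i + 1` in a box changes one letter of the reading word of its row. -/
theorem rowWord_replace {n : ℕ} {lam : ℕ → ℕ} {t : Filling} (ht : IsSVT n lam t) {i r c : ℕ}
    (hin : i < n) (hi : i ∈ t r c) (h1 : i + 1 ∉ t r c) (h2 : i ∉ t r (c + 1)) :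
    ∃ u v, rowWord n lam t r = u ++ i :: v ∧
      rowWord n lam (updateBox t r c (insert (i + 1) ((t r c).erase i))) r = u ++ (i + 1) :: v ∧
      sig i u = rowSig t i r (List.range c) ∧
      sig i v = rowSig t i r (List.range' (c + 1) (lam r - (c + 1))) := by
  set t' := updateBox t r c (insert (i + 1) ((t r c).erase i)) with ht'
  have hc := ht.lt_of_mem hi
  have hself : t' r c = insert (i + 1) ((t r c).erase i) := updateBox_self _ _ _ _
  have hne : ∀ {d}, d ≠ c → t' r d = t r d := fun h => updateBox_of_col_ne h
  have hminne : ∀ {d}, d ≠ c → boxMin t' r d = boxMin t r d := fun h => by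
    unfold boxMin; rw [hne h]
  have hright : ∀ {d x}, c < d → x ∈ t r d → i < x := by
    intro d x hd hx
    rcases Nat.lt_or_ge (c + 1) d with h | h
    · obtain ⟨y, hy⟩ := ht.boxNonempty r (c + 1) (by have := ht.lt_of_mem hx; omega)
      have a1 := ht.le_of_mem h hy hx
      have a2 := ht.le_of_mem (Nat.lt_succ_self c) hi hy
      have a3 : y ≠ i := fun h => h2 (h ▸ hy)
      omega
    · obtain rfl : d = c + 1 := by omega
      have a2 := ht.le_of_mem (Nat.lt_succ_self c) hi hx
      have a3 : x ≠ i := fun h => h2 (h ▸ hx)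
      omega
  have hleft : ∀ {d x}, d < c → x ∈ t r d → x ≤ boxMin t r c := fun hd hx => ht.le_boxMin hx hd hc
  have hminle := boxMin_le hi
  have hmin := boxMin_mem ⟨i, hi⟩
  have hex : ¬ IsExtra t r (lam r) (i + 1) := by
    rintro ⟨d, hd, hx, hx'⟩
    rcases lt_trichotomy d c with h | rfl | h
    · have := hleft h hx
      omega
    · exact h1 hx
    · have := hright h (boxMin_mem ⟨_, hx⟩)
      omega
  have hV : sig i ((List.range' (c + 1) (lam r - (c + 1))).map (boxMin t r)) =
      rowSig t i r (List.range' (c + 1) (lam r - (c + 1))) := by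
    refine sig_map_boxMin ht fun d hd => ?_
    rw [List.mem_range'_1] at hd
    exact ⟨by omega, fun x hx => hright (by omega) hx⟩
  have hmap : ∀ {L : List ℕ}, (∀ d ∈ L, d ≠ c) → L.map (boxMin t' r) = L.map (boxMin t r) :=
    fun h => List.map_congr_left fun d hd => hminne (h d hd)
  have hL1 : ∀ d ∈ List.range c, d ≠ c := fun d hd => by
    rw [List.mem_range] at hd; omega
  have hL2 : ∀ d ∈ List.range' (c + 1) (lam r - (c + 1)), d ≠ c := fun d hd => by
    rw [List.mem_range'_1] at hd; omega
  rcases hminle.eq_or_lt with hm | hm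
  · have hmin' : boxMin t' r c = i + 1 := by
      refine boxMin_eq (by simp [hself]) fun x hx => ?_
      rw [hself, Finset.mem_insert, Finset.mem_erase] at hx
      rcases hx with rfl | ⟨hx, hx'⟩
      · exact le_rfl
      · have := boxMin_le hx'
        omega
    have hexiff : ∀ x, IsExtra t' r (lam r) x ↔ IsExtra t r (lam r) x := by
      intro x
      refine exists_congr fun d => and_congr_right fun _ => ?_
      by_cases hd : d = c
      · subst hd
        rw [hself, hmin', hm, Finset.mem_insert, Finset.mem_erase]
        constructor
        · rintro ⟨rfl | h, h'⟩
          · omega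
          · exact ⟨h.2, by omega⟩
        · rintro ⟨h, h'⟩
          have : x ≠ i + 1 := fun h' => h1 (h' ▸ h)
          exact ⟨.inr ⟨by omega, h⟩, by omega⟩
      · rw [hne hd, hminne hd]
    refine ⟨(List.range (n + 1)).reverse.filter (fun x => IsExtra t r (lam r) x) ++
      (List.range c).map (boxMin t r), _, ?_, ?_, ?_, hV⟩
    · rw [rowWord, range_split hc, List.map_append, List.map_cons, hm, List.append_assoc]
    · rw [rowWord, filter_reverse_range_congr hexiff, range_split hc, List.map_append,
        List.map_cons, hmin', List.append_assoc, hmap hL1, hmap hL2]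
    · rw [sig_append, sig_filter_range, ← ht.sig_extra_mul_sig_min i r hc.le]
      have e1 : ¬ IsExtra t r c (i + 1) := fun ⟨d, hd, h⟩ => hex ⟨d, by omega, h⟩
      have e2 : IsExtra t r (lam r) i ↔ IsExtra t r c i := by
        constructor
        · rintro ⟨d, hd, hx, hx'⟩
          rcases lt_trichotomy d c with h | rfl | h
          · exact ⟨d, h, hx, hx'⟩
          · omega
          · exact absurd (hright h hx) (lt_irrefl _)
        · rintro ⟨d, hd, h⟩
          exact ⟨d, by omega, h⟩
      simp only [hex, e1, e2, and_false, if_false, show i < n + 1 by omega, true_and]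
  · have hmin' : boxMin t' r c = boxMin t r c := by
      refine boxMin_eq ?_ fun x hx => ?_
      · rw [hself, Finset.mem_insert, Finset.mem_erase]
        exact .inr ⟨hm.ne, hmin⟩
      · rw [hself, Finset.mem_insert, Finset.mem_erase] at hx
        rcases hx with rfl | ⟨hx, hx'⟩
        · omega
        · exact boxMin_le hx'
    have hexi : IsExtra t r (lam r) i := ⟨c, hc, hi, hm⟩
    have hexi' : IsExtra t' r (lam r) (i + 1) := ⟨c, hc, by simp [hself], by omega⟩
    have hexi'' : ¬ IsExtra t' r (lam r) i := by
      rintro ⟨d, hd, hx, hx'⟩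
      rcases lt_trichotomy d c with h | rfl | h
      · rw [hne h.ne] at hx
        have := hleft h hx
        omega
      · simp [hself] at hx
      · rw [hne h.ne'] at hx
        exact absurd (hright h hx) (lt_irrefl _)
    have hexiff : ∀ x, x ≠ i → x ≠ i + 1 → (IsExtra t' r (lam r) x ↔ IsExtra t r (lam r) x) := by
      intro x hx1 hx2
      refine exists_congr fun d => and_congr_right fun _ => ?_
      by_cases hd : d = c
      · subst hd
        rw [hself, hmin', Finset.mem_insert, Finset.mem_erase]
        simp [hx1, hx2]
      · rw [hne hd, hminne hd]
    have hhi : i + 1 < n + 1 := by omega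
    refine ⟨(List.range' (i + 1 + 1) (n + 1 - (i + 1 + 1))).reverse.filter
        (fun x => IsExtra t r (lam r) x),
      (List.range i).reverse.filter (fun x => IsExtra t r (lam r) x) ++
        (List.range (lam r)).map (boxMin t r), ?_, ?_, ?_, ?_⟩
    · rw [rowWord, reverse_range_split hhi, reverse_range_succ, List.filter_append,
        List.filter_cons, List.filter_cons, if_neg (by simpa using hex),
          if_pos (by simpa using hexi)]
      simp
    · rw [rowWord, reverse_range_split hhi, reverse_range_succ, List.filter_append,
        List.filter_cons, List.filter_cons, if_pos (by simpa using hexi'),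
        if_neg (by simpa using hexi'')]
      have f1 : (List.range' (i + 1 + 1) (n + 1 - (i + 1 + 1))).reverse.filter
          (fun x => IsExtra t' r (lam r) x) =
          (List.range' (i + 1 + 1) (n + 1 - (i + 1 + 1))).reverse.filter
          (fun x => IsExtra t r (lam r) x) := by
        refine List.filter_congr fun x hx => ?_
        rw [List.mem_reverse, List.mem_range'_1] at hx
        simp only [hexiff x (by omega) (by omega)]
      have f2 : (List.range i).reverse.filter (fun x => IsExtra t' r (lam r) x) =
          (List.range i).reverse.filter (fun x => IsExtra t r (lam r) x) := by
        refine List.filter_congr fun x hx => ?_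
        rw [List.mem_reverse, List.mem_range] at hx
        simp only [hexiff x (by omega) (by omega)]
      have f3 : (List.range (lam r)).map (boxMin t' r) =
          (List.range (lam r)).map (boxMin t r) := by
        refine List.map_congr_left fun d _ => ?_
        by_cases hd : d = c
        · rw [hd, hmin']
        · exact hminne hd
      rw [f1, f2, f3]
      simp
    · rw [rowSig_eq_one]
      · refine List.prod_eq_one ?_
        simp only [List.mem_map, List.mem_filter, List.mem_reverse, List.mem_range'_1]
        rintro _ ⟨x, ⟨hx, -⟩, rfl⟩
        exact letter_of_ne (by omega) (by omega)
      · intro d hd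
        rw [List.mem_range] at hd
        exact ⟨fun h => by have := hleft hd h; omega, fun h => by have := hleft hd h; omega⟩
    · rw [sig_append, sig_filter_range, if_neg (by omega), if_neg (by omega), one_mul, one_mul,
        range_split hc, List.map_append, List.map_cons, sig_append, sig_cons, hV,
        letter_of_ne (by omega) (by omega), one_mul]
      rw [show sig i ((List.range c).map (boxMin t r)) = 1 from ?_, one_mul]
      refine List.prod_eq_one ?_
      simp only [List.mem_map, List.mem_range]
      rintro _ ⟨_, ⟨d, hd, rfl⟩, rfl⟩
      have := hleft hd (boxMin_mem (ht.boxNonempty r d (by omega)))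
      exact letter_of_ne (by omega) (by omega)

/-- Moving `i` from a box containing `i` and `i + 1` to `i + 1` in the box on its left changes one
letter of the reading word of the row. -/
theorem rowWord_move {n : ℕ} {lam : ℕ → ℕ} {t : Filling} (ht : IsSVT n lam t) {i r c : ℕ}
    (hin : i < n) (hi : i ∈ t r c) (h1 : i ∈ t r (c + 1)) (h2 : i + 1 ∈ t r (c + 1)) :
    ∃ u v, rowWord n lam t r = u ++ i :: v ∧
      rowWord n lam (updateBox (updateBox t r (c + 1) ((t r (c + 1)).erase i)) r c
        (insert (i + 1) (t r c))) r = u ++ (i + 1) :: v ∧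
      sig i u = rowSig t i r (List.range c) ∧
      sig i v = rowSig t i r (List.range' (c + 1) (lam r - (c + 1))) := by
  set t' := updateBox (updateBox t r (c + 1) ((t r (c + 1)).erase i)) r c
    (insert (i + 1) (t r c)) with ht'
  have hc := ht.lt_of_mem h1
  have hself : t' r c = insert (i + 1) (t r c) := updateBox_self _ _ _ _
  have hself' : t' r (c + 1) = (t r (c + 1)).erase i := by
    rw [ht', updateBox_of_col_ne (by omega), updateBox_self]
  have hne : ∀ {d}, d ≠ c → d ≠ c + 1 → t' r d = t r d := fun h h' => by
    rw [ht', updateBox_of_col_ne h, updateBox_of_col_ne h']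
  have hle : ∀ {d x}, d ≤ c → x ∈ t r d → x ≤ i := fun hd hx => ht.le_of_mem (by omega) hx h1
  have hright : ∀ {d x}, c + 1 < d → x ∈ t r d → i < x := fun hd hx => by
    have := ht.le_of_mem hd h2 hx
    omega
  have hleft : ∀ {d x}, d < c → x ∈ t r d → x ≤ boxMin t r c :=
    fun hd hx => ht.le_boxMin hx hd (by omega)
  have hmin1 : boxMin t r (c + 1) = i :=
    boxMin_eq h1 fun x hx => ht.le_of_mem (Nat.lt_succ_self c) hi hx
  have hmin2 : boxMin t' r (c + 1) = i + 1 := by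
    refine boxMin_eq (by simp [hself', h2]) fun x hx => ?_
    rw [hself', Finset.mem_erase] at hx
    have := boxMin_le hx.2
    omega
  have hmin3 : boxMin t' r c = boxMin t r c := by
    refine boxMin_eq ?_ fun x hx => ?_
    · rw [hself]
      exact Finset.mem_insert_of_mem (boxMin_mem ⟨i, hi⟩)
    · rw [hself, Finset.mem_insert] at hx
      rcases hx with rfl | hx
      · have := boxMin_le hi
        omega
      · exact boxMin_le hx
  have hminne : ∀ {d}, d ≠ c + 1 → boxMin t' r d = boxMin t r d := fun {d} h => by
    by_cases hd : d = c
    · rw [hd, hmin3]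
    · unfold boxMin
      rw [hne hd h]
  have hexiff : ∀ x, IsExtra t' r (lam r) x ↔ IsExtra t r (lam r) x := by
    have hic : boxMin t r c < i + 1 := by have := boxMin_le hi; omega
    intro x
    constructor
    · rintro ⟨d, hd, hx, hx'⟩
      by_cases h : d = c
      · subst h
        rw [hself, Finset.mem_insert] at hx
        rw [hmin3] at hx'
        rcases hx with rfl | hx
        · exact ⟨d + 1, hc, h2, by omega⟩
        · exact ⟨d, hd, hx, hx'⟩
      · by_cases h' : d = c + 1
        · subst h'
          rw [hself', Finset.mem_erase] at hx
          exact ⟨c + 1, hd, hx.2, by omega⟩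
        · rw [hne h h'] at hx
          rw [hminne h'] at hx'
          exact ⟨d, hd, hx, hx'⟩
    · rintro ⟨d, hd, hx, hx'⟩
      by_cases h : d = c
      · subst h
        exact ⟨d, hd, by rw [hself]; exact Finset.mem_insert_of_mem hx, by omega⟩
      · by_cases h' : d = c + 1
        · subst h'
          by_cases hxi : x = i + 1
          · exact ⟨c, by omega, by simp [hself, hxi], by omega⟩
          · refine ⟨c + 1, hd, ?_, by omega⟩
            rw [hself', Finset.mem_erase]
            exact ⟨by omega, hx⟩
        · exact ⟨d, hd, by rwa [hne h h'], by rwa [hminne h']⟩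
  have hmap : ∀ {L : List ℕ}, (∀ d ∈ L, d ≠ c + 1) →
      L.map (boxMin t' r) = L.map (boxMin t r) :=
    fun h => List.map_congr_left fun d hd => hminne (h d hd)
  refine ⟨(List.range (n + 1)).reverse.filter (fun x => IsExtra t r (lam r) x) ++
      (List.range (c + 1)).map (boxMin t r),
    (List.range' (c + 1 + 1) (lam r - (c + 1 + 1))).map (boxMin t r), ?_, ?_, ?_, ?_⟩
  · rw [rowWord, range_split hc, List.map_append, List.map_cons, hmin1, List.append_assoc]
  · rw [rowWord, filter_reverse_range_congr hexiff, range_split hc, List.map_append,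
      List.map_cons, hmin2, List.append_assoc, hmap, hmap]
    · intro d hd
      rw [List.mem_range'_1] at hd
      omega
    · intro d hd
      rw [List.mem_range] at hd
      omega
  · have e := ht.sig_extra_mul_sig_min i r (show c + 1 ≤ lam r by omega)
    have e1 : ¬ IsExtra t r (c + 1) (i + 1) := by
      rintro ⟨d, hd, hx, -⟩
      have := hle (by omega) hx
      omega
    have e2 : IsExtra t r (lam r) (i + 1) := ⟨c + 1, hc, h2, by omega⟩
    have e3 : IsExtra t r (lam r) i ↔ IsExtra t r (c + 1) i := by
      constructor
      · rintro ⟨d, hd, hx, hx'⟩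
        rcases lt_trichotomy d (c + 1) with h | rfl | h
        · exact ⟨d, h, hx, hx'⟩
        · omega
        · exact absurd (hright h hx) (lt_irrefl _)
      · rintro ⟨d, hd, h⟩
        exact ⟨d, by omega, h⟩
    have e4 : i + 1 ∉ t r c := fun h => by
      have := hle le_rfl h
      omega
    rw [if_neg e1, one_mul, List.range_succ (n := c), rowSig_append, rowSig_singleton,
      show cellSig t i r c = Bic.plus by simp [cellSig, hi, e4], ← List.range_succ] at e
    rw [sig_append, sig_filter_range]
    simp only [e2, e3, show i + 1 < n + 1 by omega, show i < n + 1 by omega, true_and, if_true]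
    rw [mul_assoc, e, ← mul_assoc, Bic.minus_mul_mul_plus]
    refine rowSig_m fun d hd h => ?_
    have := hle (List.mem_range.1 hd).le h
    omega
  · obtain ⟨k, hk⟩ : ∃ k, lam r - (c + 1) = k + 1 := ⟨lam r - (c + 2), by omega⟩
    rw [hk, List.range'_succ, rowSig_cons, cellSig_eq_one_of_mem h1 h2, one_mul,
      show lam r - (c + 1 + 1) = k by omega]
    refine sig_map_boxMin ht fun d hd => ?_
    rw [List.mem_range'_1] at hd
    exact ⟨by omega, fun x hx => hright (by omega) hx⟩

/-- Changing a letter `i` into `i + 1` in one row of the tableau is an `f_i`-step on reading words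
as soon as the column of this letter is the rightmost uncancelled `+`. -/
theorem IsSVT.fStep_reading {n : ℕ} {lam : ℕ → ℕ} {t t' : Filling} (ht : IsSVT n lam t)
    (hlam : Antitone lam) {i r c : ℕ} (hr : r < n) (hi : i ∈ t r c) (h1 : ¬ colHas n t (i + 1) c)
    (hm : ((List.range c).map (colBic n t i)).prod.m = 0)
    (hp : ((List.range' (c + 1) (lam 0 - (c + 1))).map (colBic n t i)).prod.p = 0)
    (hoff : ∀ r', r' ≠ r → ∀ d, t' r' d = t r' d)
    (hw : ∃ u v, rowWord n lam t r = u ++ i :: v ∧ rowWord n lam t' r = u ++ (i + 1) :: v ∧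
      sig i u = rowSig t i r (List.range c) ∧
      sig i v = rowSig t i r (List.range' (c + 1) (lam r - (c + 1)))) :
    FStep i (reading n lam t) (reading n lam t') ∧
      ∀ r', (rowWord n lam t' r').length = (rowWord n lam t r').length := by
  obtain ⟨u, v, hu, hv, hsu, hsv⟩ := hw
  have hc := ht.lt_of_mem hi
  have hc0 : c < lam 0 := hc.trans_le (hlam (Nat.zero_le r))
  have hrow : ∀ r', r' ≠ r → rowWord n lam t' r' = rowWord n lam t r' :=
    fun r' h => rowWord_congr (hoff r' h)
  have hbelow : ∀ r', r < r' → r' < n → ∀ d, c ≤ d → i ∉ t r' d ∧ i + 1 ∉ t r' d := by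
    intro r' h h' d hd
    refine ⟨fun hx => (ht.lt_of_mem_of_le hlam h hd hi hx).false, fun hx => ?_⟩
    rcases hd.eq_or_lt with rfl | hd
    · exact h1 ⟨r', h', hx⟩
    · obtain ⟨y, hy⟩ := ht.boxNonempty r' c (hd.trans (ht.lt_of_mem hx))
      have a1 := ht.le_of_mem hd hy hx
      have a2 := ht.lt_of_mem_col hlam h hi hy
      exact h1 ⟨r', h', (show y = i + 1 by omega) ▸ hy⟩
  have habove : ∀ r', r' < r → ∀ d, d ≤ c → i ∉ t r' d ∧ i + 1 ∉ t r' d := by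
    intro r' h d hd
    constructor <;> intro hx <;> have := ht.lt_of_mem_of_le hlam h hd hx hi <;> omega
  have hsplit := range_split hc0
  have hU : sig i (((List.range' (r + 1) (n - (r + 1))).reverse).flatMap (rowWord n lam t) ++ u) =
      ((List.range c).map (colBic n t i)).prod := by
    rw [sig_append, ht.sig_flatMap_rowWord hlam, hsu, List.range_eq_range' (n := c),
      ← prod_rowSig_eq_prod_colBic ht hlam, reverse_range_split hr, List.map_append,
      List.map_cons, List.prod_append, List.prod_cons, ← List.range_eq_range' (n := c)]
    have e1 : ((List.range r).reverse.map fun r' => rowSig t i r' (List.range c)).prod = 1 := by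
      refine List.prod_eq_one ?_
      simp only [List.mem_map, List.mem_reverse, List.mem_range]
      rintro _ ⟨r', hr', rfl⟩
      exact rowSig_eq_one fun d hd => habove r' hr' d (List.mem_range.1 hd).le
    rw [e1, mul_one]
    congr 2
    refine List.map_congr_left fun r' hr' => ?_
    rw [List.mem_reverse, List.mem_range'_1] at hr'
    rw [hsplit, rowSig_append, rowSig_eq_one (L := c :: _), mul_one]
    intro d hd
    rw [List.mem_cons, List.mem_range'_1] at hd
    exact hbelow r' (by omega) (by omega) d (by omega)
  have hV : sig i (v ++ ((List.range r).reverse).flatMap (rowWord n lam t)) =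
      ((List.range' (c + 1) (lam 0 - (c + 1))).map (colBic n t i)).prod := by
    rw [sig_append, ht.sig_flatMap_rowWord hlam, hsv,
      ← prod_rowSig_eq_prod_colBic ht hlam, reverse_range_split hr, List.map_append,
      List.map_cons, List.prod_append, List.prod_cons]
    have e1 : ((List.range' (r + 1) (n - (r + 1))).reverse.map fun r' =>
        rowSig t i r' (List.range' (c + 1) (lam 0 - (c + 1)))).prod = 1 := by
      refine List.prod_eq_one ?_
      simp only [List.mem_map, List.mem_reverse, List.mem_range'_1]
      rintro _ ⟨r', hr', rfl⟩
      refine rowSig_eq_one fun d hd => ?_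
      rw [List.mem_range'_1] at hd
      exact hbelow r' (by omega) (by omega) d (by omega)
    have e2 : rowSig t i r (List.range' (c + 1) (lam 0 - (c + 1))) =
        rowSig t i r (List.range' (c + 1) (lam r - (c + 1))) := by
      obtain ⟨k, hk⟩ := Nat.exists_eq_add_of_le (hlam (Nat.zero_le r))
      rw [show lam 0 - (c + 1) = (lam r - (c + 1)) + k by omega,
        ← List.range'_append, rowSig_append, rowSig_eq_one (L := List.range' _ k), mul_one]
      intro d hd
      rw [List.mem_range'_1] at hd
      constructor <;> intro hx <;> have := ht.lt_of_mem hx <;> omega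
    rw [e1, one_mul, e2]
    congr 2
    refine List.map_congr_left fun r' hr' => ?_
    rw [List.mem_reverse, List.mem_range] at hr'
    rw [hsplit, rowSig_append, rowSig_cons, cellSig_eq_one (habove r' hr' c le_rfl).1
      (habove r' hr' c le_rfl).2, one_mul, rowSig_eq_one (L := List.range c), one_mul]
    exact fun d hd => habove r' hr' d (List.mem_range.1 hd).le
  constructor
  · refine ⟨_, _, ?_, ?_, hU ▸ hm, hV ▸ hp⟩
    · rw [reading, reverse_range_split hr, List.flatMap_append, List.flatMap_cons, hu]
      simp
    · have f : ∀ L : List ℕ, (∀ r' ∈ L, r' ≠ r) →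
          L.flatMap (rowWord n lam t') = L.flatMap (rowWord n lam t) := fun L hL => by
        rw [List.flatMap_def, List.flatMap_def, List.map_congr_left fun r' h => hrow r' (hL r' h)]
      rw [reading, reverse_range_split hr, List.flatMap_append, List.flatMap_cons, hv, f, f]
      · simp
      · intro r' h
        rw [List.mem_reverse, List.mem_range] at h
        omega
      · intro r' h
        rw [List.mem_reverse, List.mem_range'_1] at h
        omega
  · intro r'
    by_cases h : r' = r
    · rw [h, hu, hv]
      simp
    · rw [hrow r' h]

/-! ### Column signatures -/

theorem colHas_of_some_true {n i c : ℕ} {t : Filling} (h : colSign n t i c = some true) :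
    colHas n t i c ∧ ¬ colHas n t (i + 1) c := by
  unfold colSign at h
  split_ifs at h with h1
  · exact h1
  · simp at h

theorem colHas_of_some_false {n i c : ℕ} {t : Filling} (h : colSign n t i c = some false) :
    colHas n t (i + 1) c ∧ ¬ colHas n t i c := by
  unfold colSign at h
  split_ifs at h with h1 h2
  · simp at h
  · exact h2

theorem colBic_eq (n : ℕ) (t : Filling) (i c : ℕ) : colBic n t i c =
    match colSign n t i c with
    | some true => Bic.plus
    | some false => Bic.minus
    | none => 1 := by
  unfold colBic colSign
  by_cases h1 : colHas n t i c <;> by_cases h2 : colHas n t (i + 1) c <;>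
    simp [h1, h2, Bic.minus_mul_plus]

theorem pctr_filterMap (n : ℕ) (t : Filling) (i : ℕ) (L : List ℕ) :
    pctr (L.filterMap (colSign n t i)) = (L.map (colBic n t i)).prod.p := by
  induction L with
  | nil => rfl
  | cons c L ih =>
    rw [List.map_cons, List.prod_cons, Bic.mul_p, ← ih, colBic_eq, List.filterMap_cons]
    rcases colSign n t i c with _ | _ | _
    · simp [Bic.one_p, Bic.one_m]
    · simp [Bic.minus_p, Bic.minus_m, pctr]
    · simp [Bic.plus_p, Bic.plus_m, pctr, add_comm]

theorem mctr_filterMap (n : ℕ) (t : Filling) (i : ℕ) (L : List ℕ) :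
    mctr (L.filterMap (colSign n t i)) = (L.map (colBic n t i)).prod.m := by
  induction L using List.reverseRecOn with
  | nil => rfl
  | append_singleton L c ih =>
    rw [List.map_append, List.prod_append, List.map_singleton, List.prod_singleton, Bic.mul_m,
      ← ih, colBic_eq, List.filterMap_append]
    rcases h : colSign n t i c with _ | _ | _
    · simp [h, Bic.one_p, Bic.one_m]
    · simp [h, Bic.minus_p, Bic.minus_m, mctr, add_comm]
    · simp [h, Bic.plus_p, Bic.plus_m, mctr]

theorem plusCol_iff {n ncols i c : ℕ} {t : Filling} : PlusCol n ncols t i c ↔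
    c < ncols ∧ colSign n t i c = some true ∧ ((List.range c).map (colBic n t i)).prod.m = 0 := by
  rw [PlusCol, colWordBefore, mctr_filterMap]

theorem minusCol_iff {n ncols i c : ℕ} {t : Filling} : MinusCol n ncols t i c ↔
    c < ncols ∧ colSign n t i c = some false ∧
      ((List.range' (c + 1) (ncols - (c + 1))).map (colBic n t i)).prod.p = 0 := by
  rw [MinusCol, colWordAfter, pctr_filterMap, List.range_eq_range', List.drop_range']
  simp

/-- An interval with an uncancelled `+`, preceded by no uncancelled `-`, contains an uncancelled
`+` column. -/
theorem exists_plusCol {n ncols i a b : ℕ} {t : Filling} (hb : a + b ≤ ncols)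
    (ha : ((List.range a).map (colBic n t i)).prod.m = 0)
    (h : 0 < ((List.range' a b).map (colBic n t i)).prod.p) :
    ∃ c, a ≤ c ∧ PlusCol n ncols t i c := by
  induction b with
  | zero => simp [Bic.one_p] at h
  | succ b ih =>
    by_cases h' : 0 < ((List.range' a b).map (colBic n t i)).prod.p
    · exact ih (by omega) h'
    · have e : ((List.range (a + b)).map (colBic n t i)).prod =
          ((List.range a).map (colBic n t i)).prod *
            ((List.range' a b).map (colBic n t i)).prod := by
        rw [← List.prod_append, ← List.map_append, List.range_eq_range', List.range_eq_range']
        have := List.range'_append (s := 0) (m := a) (n := b) (step := 1)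
        rw [one_mul, zero_add] at this
        rw [this]
      rw [List.range'_1_concat, List.map_append, List.prod_append, List.map_singleton,
        List.prod_singleton, Bic.mul_p, colBic_eq] at h
      refine ⟨a + b, by omega, plusCol_iff.2 ⟨by omega, ?_, ?_⟩⟩
      all_goals rcases hs : colSign n t i (a + b) with _ | _ | _ <;>
        simp only [hs, Bic.one_p, Bic.plus_p, Bic.minus_p] at h
      all_goals first | rfl | omega | skip
      rw [e, Bic.mul_m, ha]
      omega

/-- An interval with an uncancelled `-`, followed by no uncancelled `+`, contains an uncancelled
`-` column. -/
theorem exists_minusCol {n ncols i a b : ℕ} {t : Filling} (hb : a + b ≤ ncols)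
    (ha : ((List.range' (a + b) (ncols - (a + b))).map (colBic n t i)).prod.p = 0)
    (h : 0 < ((List.range' a b).map (colBic n t i)).prod.m) :
    ∃ c, c < a + b ∧ MinusCol n ncols t i c := by
  induction b generalizing a with
  | zero => simp [Bic.one_m] at h
  | succ b ih =>
    rw [show a + (b + 1) = a + 1 + b by omega] at ha hb ⊢
    by_cases h' : 0 < ((List.range' (a + 1) b).map (colBic n t i)).prod.m
    · exact ih hb ha h'
    · have e : ((List.range' (a + 1) (ncols - (a + 1))).map (colBic n t i)).prod =
          ((List.range' (a + 1) b).map (colBic n t i)).prod *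
            ((List.range' (a + 1 + b) (ncols - (a + 1 + b))).map (colBic n t i)).prod := by
        have := List.range'_append (s := a + 1) (m := b) (n := ncols - (a + 1 + b)) (step := 1)
        rw [one_mul, show b + (ncols - (a + 1 + b)) = ncols - (a + 1) by omega] at this
        rw [← List.prod_append, ← List.map_append, this]
      rw [List.range'_succ, List.map_cons, List.prod_cons, Bic.mul_m, colBic_eq] at h
      refine ⟨a, by omega, minusCol_iff.2 ⟨by omega, ?_, ?_⟩⟩
      all_goals rcases hs : colSign n t i a with _ | _ | _ <;>
        simp only [hs, Bic.one_m, Bic.plus_m, Bic.minus_m] at h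
      all_goals first | rfl | omega | skip
      rw [e, Bic.mul_p, ha]
      omega

theorem exists_fBoxCol {n ncols i : ℕ} {t : Filling}
    (h : 0 < ((List.range ncols).map (colBic n t i)).prod.p) : ∃ c, fBoxCol n ncols t i c := by
  rw [List.range_eq_range'] at h
  obtain ⟨c, -, hc⟩ := exists_plusCol (a := 0) (b := ncols) (ncols := ncols) (by omega) (by rfl) h
  have hne : ((Finset.range ncols).filter fun c => PlusCol n ncols t i c).Nonempty :=
    ⟨c, Finset.mem_filter.2 ⟨Finset.mem_range.2 hc.1, hc⟩⟩
  obtain ⟨d, hd, hmax⟩ := Finset.exists_max_image _ id hne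
  exact ⟨d, (Finset.mem_filter.1 hd).2, fun c' hc' =>
    hmax c' (Finset.mem_filter.2 ⟨Finset.mem_range.2 hc'.1, hc'⟩)⟩

theorem exists_eBoxCol {n ncols i : ℕ} {t : Filling}
    (h : 0 < ((List.range ncols).map (colBic n t i)).prod.m) : ∃ c, eBoxCol n ncols t i c := by
  rw [List.range_eq_range'] at h
  obtain ⟨c, -, hc⟩ := exists_minusCol (a := 0) (b := ncols) (ncols := ncols) (by omega)
    (by simp [Bic.one_p]) h
  exact ⟨Nat.find ⟨c, hc⟩, Nat.find_spec (p := MinusCol n ncols t i) ⟨c, hc⟩,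
    fun c' hc' => Nat.find_min' ⟨c, hc⟩ hc'⟩

section
variable {n ncols i c : ℕ} {t : Filling}

theorem fBoxCol.prod_right (h : fBoxCol n ncols t i c) :
    ((List.range' (c + 1) (ncols - (c + 1))).map (colBic n t i)).prod.p = 0 := by
  obtain ⟨h1, h2⟩ := h
  obtain ⟨a1, a2, a3⟩ := plusCol_iff.1 h1
  by_contra hp
  obtain ⟨d, hd, hd'⟩ := exists_plusCol (a := c + 1) (b := ncols - (c + 1)) (ncols := ncols)
    (by omega) (by
      rw [List.range_succ, List.map_append, List.prod_append, Bic.mul_m, a3]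
      simp [colBic_eq, a2, Bic.plus_m]) (Nat.pos_of_ne_zero hp)
  have := h2 d hd'
  omega

theorem fBoxCol.colSign_succ_ne (h : fBoxCol n ncols t i c) (hc : c + 1 < ncols) :
    colSign n t i (c + 1) ≠ some true := by
  intro h'
  obtain ⟨h1, h2⟩ := h
  obtain ⟨a1, a2, a3⟩ := plusCol_iff.1 h1
  have := h2 (c + 1) (plusCol_iff.2 ⟨hc, h', by
    rw [List.range_succ, List.map_append, List.prod_append, Bic.mul_m, a3]
    simp [colBic_eq, a2, Bic.plus_m]⟩)
  omega

theorem eBoxCol.prod_left (h : eBoxCol n ncols t i c) :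
    ((List.range c).map (colBic n t i)).prod.m = 0 := by
  obtain ⟨h1, h2⟩ := h
  obtain ⟨a1, a2, a3⟩ := minusCol_iff.1 h1
  by_contra hp
  rw [List.range_eq_range'] at hp
  obtain ⟨d, hd, hd'⟩ := exists_minusCol (a := 0) (b := c) (ncols := ncols) (by omega) (by
      rw [zero_add, show ncols - c = ncols - (c + 1) + 1 by omega, List.range'_succ,
        List.map_cons, List.prod_cons, Bic.mul_p, a3]
      simp [colBic_eq, a2, Bic.minus_p]) (Nat.pos_of_ne_zero hp)
  have := h2 d hd'
  omega

theorem eBoxCol.colSign_pred_ne (h : eBoxCol n ncols t i (c + 1)) :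
    colSign n t i c ≠ some false := by
  intro h'
  obtain ⟨h1, h2⟩ := h
  obtain ⟨a1, a2, a3⟩ := minusCol_iff.1 h1
  have := h2 c (minusCol_iff.2 ⟨by omega, h', by
    rw [show ncols - (c + 1) = ncols - (c + 1 + 1) + 1 by omega, List.range'_succ,
        List.map_cons, List.prod_cons, Bic.mul_p, a3]
    simp [colBic_eq, a2, Bic.minus_p]⟩)
  omega

end

theorem colHas_congr {n a d : ℕ} {t t' : Filling} (h : ∀ r, t' r d = t r d) :
    colHas n t' a d ↔ colHas n t a d := by
  simp only [colHas, h]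

theorem map_colBic_congr {n i : ℕ} {t t' : Filling} {L : List ℕ}
    (h : ∀ d ∈ L, ∀ r, t' r d = t r d) : L.map (colBic n t' i) = L.map (colBic n t i) :=
  List.map_congr_left fun d hd => by
    unfold colBic
    simp only [colHas_congr (h d hd)]

/-! ### The crystal operators on tableaux -/

theorem exists_of_fRaw {n i : ℕ} {lam : ℕ → ℕ} {t t' : Filling} (h : fRaw n lam i t = some t') :
    ∃ c r, fBoxCol n (lam 0) t i c ∧ r < n ∧ i ∈ t r c ∧
      ((i ∈ t r (c + 1) ∧ t' = updateBox (updateBox t r (c + 1) ((t r (c + 1)).erase i)) r c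
          (insert (i + 1) (t r c))) ∨
        (i ∉ t r (c + 1) ∧ t' = updateBox t r c (insert (i + 1) ((t r c).erase i)))) := by
  unfold fRaw at h
  split_ifs at h with h1
  have h2 := (colHas_of_some_true (Classical.choose_spec h1).1.2.1).1
  simp only [colHas] at h2
  simp only [dif_pos h2] at h
  refine ⟨_, _, Classical.choose_spec h1, (Classical.choose_spec h2).1,
    (Classical.choose_spec h2).2, ?_⟩
  split_ifs at h with h3
  · exact .inl ⟨h3, (Option.some.inj h).symm⟩
  · exact .inr ⟨h3, (Option.some.inj h).symm⟩

theorem fRaw_ne_none {n i c : ℕ} {lam : ℕ → ℕ} {t : Filling} (h : fBoxCol n (lam 0) t i c) :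
    fRaw n lam i t ≠ none := by
  have h1 : ∃ c, fBoxCol n (lam 0) t i c := ⟨c, h⟩
  have h2 := (colHas_of_some_true (Classical.choose_spec h1).1.2.1).1
  unfold fRaw
  rw [dif_pos h1]
  simp only [colHas] at h2
  simp only [dif_pos h2]
  split_ifs <;> simp

theorem exists_of_eRaw {n i : ℕ} {lam : ℕ → ℕ} {t t' : Filling} (h : eRaw n lam i t = some t') :
    ∃ c r, eBoxCol n (lam 0) t i c ∧ r < n ∧ i + 1 ∈ t r c ∧
      (((0 < c ∧ i + 1 ∈ t r (c - 1)) ∧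
        t' = updateBox (updateBox t r (c - 1) ((t r (c - 1)).erase (i + 1))) r c
          (insert i (t r c))) ∨
        (¬ (0 < c ∧ i + 1 ∈ t r (c - 1)) ∧
          t' = updateBox t r c (insert i ((t r c).erase (i + 1))))) := by
  unfold eRaw at h
  split_ifs at h with h1
  have h2 := (colHas_of_some_false (Classical.choose_spec h1).1.2.1).1
  simp only [colHas] at h2
  simp only [dif_pos h2] at h
  refine ⟨_, _, Classical.choose_spec h1, (Classical.choose_spec h2).1,
    (Classical.choose_spec h2).2, ?_⟩
  split_ifs at h with h3
  · exact .inl ⟨h3, (Option.some.inj h).symm⟩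
  · exact .inr ⟨h3, (Option.some.inj h).symm⟩

theorem eRaw_ne_none {n i c : ℕ} {lam : ℕ → ℕ} {t : Filling} (h : eBoxCol n (lam 0) t i c) :
    eRaw n lam i t ≠ none := by
  have h1 : ∃ c, eBoxCol n (lam 0) t i c := ⟨c, h⟩
  have h2 := (colHas_of_some_false (Classical.choose_spec h1).1.2.1).1
  unfold eRaw
  rw [dif_pos h1]
  simp only [colHas] at h2
  simp only [dif_pos h2]
  split_ifs <;> simp

theorem IsPartitionShape.antitone {n : ℕ} {lam : ℕ → ℕ} (h : IsPartitionShape n lam) :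
    Antitone lam := antitone_nat_of_succ_le h.1

namespace IsSVT

variable {n : ℕ} {lam : ℕ → ℕ} {t : Filling} {i r c : ℕ}

theorem updateBox (ht : IsSVT n lam t) {A : Finset ℕ} (hc : c < lam r) (hA : A.Nonempty)
    (hb : ∀ a ∈ A, 1 ≤ a ∧ a ≤ n) (hl : ∀ d, d + 1 = c → ∀ a ∈ t r d, ∀ b ∈ A, a ≤ b)
    (hr : ∀ a ∈ A, ∀ b ∈ t r (c + 1), a ≤ b)
    (hu : ∀ s, s + 1 = r → ∀ a ∈ t s c, ∀ b ∈ A, a < b)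
    (hd : ∀ a ∈ A, ∀ b ∈ t (r + 1) c, a < b) : IsSVT n lam (updateBox t r c A) := by
  refine ⟨fun r' c' h => ?_, fun r' c' h => ?_, fun r' c' a h => ?_, fun r' c' a b ha hb' => ?_,
    fun r' c' a b ha hb' => ?_⟩
  · unfold SVTCrystal.updateBox
    split_ifs
    · exact hA
    · exact ht.boxNonempty r' c' h
  · unfold SVTCrystal.updateBox
    rw [if_neg (by rintro ⟨rfl, rfl⟩; exact h hc), ht.emptyOutside r' c' h]
  · unfold SVTCrystal.updateBox at h
    split_ifs at h
    · exact hb a h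
    · exact ht.entryBounds r' c' a h
  · unfold SVTCrystal.updateBox at ha hb'
    split_ifs at ha hb' with h1 h2 h2
    · omega
    · rw [h1.1, h1.2] at hb'
      exact hr a ha b hb'
    · rw [h2.1] at ha
      exact hl c' h2.2 a ha b hb'
    · exact ht.rowWeak r' c' a b ha hb'
  · unfold SVTCrystal.updateBox at ha hb'
    split_ifs at ha hb' with h1 h2 h2
    · omega
    · rw [h1.1, h1.2] at hb'
      exact hd a ha b hb'
    · rw [h2.2] at ha
      exact hu r' h2.1 a ha b hb'
    · exact ht.colStrict r' c' a b ha hb'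

/-- In an SVT, if `i` and `i + 1` lie in column `c + 1`, `i` lies in box `(r, c)` and `(r, c + 1)`,
and column `c` does not contain `i + 1`, then `i + 1` lies in box `(r, c + 1)`. -/
theorem succ_mem_right (ht : IsSVT n lam t) (hlam : Antitone lam) (hi : i ∈ t r c)
    (h1 : ¬ colHas n t (i + 1) c) (h2 : i ∈ t r (c + 1)) (h3 : colHas n t (i + 1) (c + 1)) :
    i + 1 ∈ t r (c + 1) := by
  obtain ⟨s, hs, hx⟩ := h3
  rcases lt_trichotomy s r with h | rfl | h
  · have := ht.lt_of_mem_col hlam h hx h2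
    omega
  · exact hx
  · obtain ⟨y, hy⟩ := ht.boxNonempty s c (by have := ht.lt_of_mem hx; omega)
    have a1 := ht.le_of_mem (Nat.lt_succ_self c) hy hx
    have a2 := ht.lt_of_mem_col hlam h hi hy
    exact absurd ⟨s, hs, (show y = i + 1 by omega) ▸ hy⟩ h1

theorem mem_left (ht : IsSVT n lam t) (hlam : Antitone lam) (hi : i + 1 ∈ t r (c + 1))
    (h1 : ¬ colHas n t i (c + 1)) (h2 : i + 1 ∈ t r c) (h3 : colHas n t i c) :
    i ∈ t r c := by
  obtain ⟨s, hs, hx⟩ := h3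
  rcases lt_trichotomy s r with h | rfl | h
  · obtain ⟨y, hy⟩ := ht.boxNonempty s (c + 1) ((ht.lt_of_mem hi).trans_le (hlam h.le))
    have a1 := ht.le_of_mem (Nat.lt_succ_self c) hx hy
    have a2 := ht.lt_of_mem_col hlam h hy hi
    exact absurd ⟨s, hs, (show y = i by omega) ▸ hy⟩ h1
  · exact hx
  · have := ht.lt_of_mem_col hlam h h2 hx
    omega

theorem row_lt (ht : IsSVT n lam t) (hlam : IsPartitionShape n lam) {a : ℕ} (h : a ∈ t r c) :
    r < n := by
  by_contra hr
  have := ht.lt_of_mem h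
  rw [hlam.2 r (by omega)] at this
  omega

theorem fRaw_spec (ht : IsSVT n lam t) (hlam : IsPartitionShape n lam) (hin : i < n)
    {t' : Filling} (h : fRaw n lam i t = some t') :
    IsSVT n lam t' ∧ FStep i (reading n lam t) (reading n lam t') ∧
      ∀ r, (rowWord n lam t' r).length = (rowWord n lam t r).length := by
  obtain ⟨c, r, hbox, hr, hi, hcase⟩ := exists_of_fRaw h
  have hanti := hlam.antitone
  have h1 := (colHas_of_some_true hbox.1.2.1).2
  have hm := (plusCol_iff.1 hbox.1).2.2
  have hp := hbox.prod_right
  have hnot : ∀ {s}, i + 1 ∉ t s c := fun {s} hx => h1 ⟨s, ht.row_lt hlam hx, hx⟩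
  have hbd : ∀ d, d ∈ t (r + 1) c → i + 1 < d := fun d hd => by
    have a1 := ht.colStrict r c i d hi hd
    have a2 : d ≠ i + 1 := fun e => hnot (e ▸ hd)
    omega
  rcases hcase with ⟨h2, rfl⟩ | ⟨h2, rfl⟩
  · have hlt := ht.lt_of_mem h2
    have h4 : i + 1 ∈ t r (c + 1) := by
      refine ht.succ_mem_right hanti hi h1 h2 ?_
      have a1 := hbox.colSign_succ_ne (hlt.trans_le (hanti (Nat.zero_le r)))
      by_contra a2
      exact a1 (by unfold colSign; rw [if_pos ⟨⟨r, hr, h2⟩, a2⟩])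
    refine ⟨?_, ?_⟩
    · have ht1 : IsSVT n lam (SVTCrystal.updateBox t r (c + 1) ((t r (c + 1)).erase i)) := by
        refine ht.updateBox hlt ⟨i + 1, by simp [h4]⟩ ?_ ?_ ?_ ?_ ?_
        · exact fun a ha => ht.entryBounds _ _ a (Finset.mem_of_mem_erase ha)
        · rintro d hd a ha b hb
          obtain rfl : d = c := by omega
          exact ht.rowWeak _ _ a b ha (Finset.mem_of_mem_erase hb)
        · exact fun a ha b hb => ht.rowWeak _ _ a b (Finset.mem_of_mem_erase ha) hb
        · rintro s rfl a ha b hb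
          exact ht.colStrict _ _ a b ha (Finset.mem_of_mem_erase hb)
        · exact fun a ha b hb => ht.colStrict _ _ a b (Finset.mem_of_mem_erase ha) hb
      refine ht1.updateBox (ht.lt_of_mem hi) ⟨i + 1, by simp⟩ ?_ ?_ ?_ ?_ ?_
      · intro a ha
        rcases Finset.mem_insert.1 ha with rfl | ha
        · omega
        · exact ht.entryBounds _ _ a ha
      · rintro d rfl a ha b hb
        rw [updateBox_of_col_ne (by omega)] at ha
        rcases Finset.mem_insert.1 hb with rfl | hb
        · have := ht.rowWeak _ _ a i ha hi
          omega
        · exact ht.rowWeak _ _ a b ha hb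
      · intro a ha b hb
        rw [updateBox_self, Finset.mem_erase] at hb
        have := ht.rowWeak _ _ i b hi hb.2
        rcases Finset.mem_insert.1 ha with rfl | ha
        · omega
        · exact ht.rowWeak _ _ a b ha hb.2
      · rintro s rfl a ha b hb
        rw [updateBox_of_col_ne (by omega)] at ha
        rcases Finset.mem_insert.1 hb with rfl | hb
        · have := ht.colStrict _ _ a i ha hi
          omega
        · exact ht.colStrict _ _ a b ha hb
      · intro a ha b hb
        rw [updateBox_of_col_ne (by omega)] at hb
        rcases Finset.mem_insert.1 ha with rfl | ha
        · exact hbd b hb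
        · exact ht.colStrict _ _ a b ha hb
    · refine ht.fStep_reading hanti hr hi h1 hm hp ?_ (rowWord_move ht hin hi h2 h4)
      intro s hs d
      rw [updateBox_of_row_ne hs, updateBox_of_row_ne hs]
  · refine ⟨?_, ?_⟩
    · refine ht.updateBox (ht.lt_of_mem hi) ⟨i + 1, by simp⟩ ?_ ?_ ?_ ?_ ?_
      · intro a ha
        rcases Finset.mem_insert.1 ha with rfl | ha
        · omega
        · exact ht.entryBounds _ _ a (Finset.mem_of_mem_erase ha)
      · rintro d rfl a ha b hb
        rcases Finset.mem_insert.1 hb with rfl | hb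
        · have := ht.rowWeak _ _ a i ha hi
          omega
        · exact ht.rowWeak _ _ a b ha (Finset.mem_of_mem_erase hb)
      · intro a ha b hb
        have a1 := ht.rowWeak _ _ i b hi hb
        have a2 : b ≠ i := fun e => h2 (e ▸ hb)
        rcases Finset.mem_insert.1 ha with rfl | ha
        · omega
        · exact ht.rowWeak _ _ a b (Finset.mem_of_mem_erase ha) hb
      · rintro s rfl a ha b hb
        rcases Finset.mem_insert.1 hb with rfl | hb
        · have := ht.colStrict _ _ a i ha hi
          omega
        · exact ht.colStrict _ _ a b ha (Finset.mem_of_mem_erase hb)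
      · intro a ha b hb
        rcases Finset.mem_insert.1 ha with rfl | ha
        · exact hbd b hb
        · exact ht.colStrict _ _ a b (Finset.mem_of_mem_erase ha) hb
    · refine ht.fStep_reading hanti hr hi h1 hm hp ?_ (rowWord_replace ht hin hi hnot h2)
      intro s hs d
      rw [updateBox_of_row_ne hs]

theorem eRaw_spec (ht : IsSVT n lam t) (hlam : IsPartitionShape n lam) (h1i : 1 ≤ i) (hin : i < n)
    {t' : Filling} (h : eRaw n lam i t = some t') :
    IsSVT n lam t' ∧ FStep i (reading n lam t') (reading n lam t) ∧
      ∀ r, (rowWord n lam t r).length = (rowWord n lam t' r).length := by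
  obtain ⟨c, r, hbox, hr, hi, hcase⟩ := exists_of_eRaw h
  have hanti := hlam.antitone
  have h1 := (colHas_of_some_false hbox.1.2.1).2
  have hp := (minusCol_iff.1 hbox.1).2.2
  have hm := hbox.prod_left
  have hnot : ∀ {s}, i ∉ t s c := fun {s} hx => h1 ⟨s, ht.row_lt hlam hx, hx⟩
  have hbd : ∀ s, s + 1 = r → ∀ d, d ∈ t s c → d < i := by
    rintro s rfl d hd
    have a1 := ht.colStrict s c d _ hd hi
    have a2 : d ≠ i := fun e => hnot (e ▸ hd)
    omega
  have hc0 : c < lam 0 := (ht.lt_of_mem hi).trans_le (hanti (Nat.zero_le r))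
  rcases hcase with ⟨⟨hc, h2⟩, rfl⟩ | ⟨h2, rfl⟩
  · obtain ⟨c, rfl⟩ := Nat.exists_eq_succ_of_ne_zero hc.ne'
    rw [Nat.succ_eq_add_one] at *
    rw [Nat.add_sub_cancel] at *
    have hlt := ht.lt_of_mem hi
    have h3 : colHas n t i c := by
      have a1 := hbox.colSign_pred_ne
      by_contra a2
      have a3 : colHas n t (i + 1) c := ⟨r, hr, h2⟩
      exact a1 (by unfold colSign; rw [if_neg (fun h => a2 h.1), if_pos ⟨a3, a2⟩])
    have h4 : i ∈ t r c := ht.mem_left hanti hi h1 h2 h3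
    set t' := SVTCrystal.updateBox (SVTCrystal.updateBox t r c ((t r c).erase (i + 1))) r (c + 1)
      (insert i (t r (c + 1))) with ht'
    have e1 : t' r (c + 1) = insert i (t r (c + 1)) := updateBox_self _ _ _ _
    have e2 : t' r c = (t r c).erase (i + 1) := by
      rw [ht', updateBox_of_col_ne (by omega), updateBox_self]
    have e3 : ∀ s d, (s ≠ r ∨ (d ≠ c ∧ d ≠ c + 1)) → t' s d = t s d := by
      intro s d hsd
      simp only [ht', SVTCrystal.updateBox]
      rw [if_neg (by omega), if_neg (by omega)]
    have hsvt : IsSVT n lam t' := by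
      have ht1 : IsSVT n lam (SVTCrystal.updateBox t r c ((t r c).erase (i + 1))) := by
        refine ht.updateBox (by omega) ⟨i, by simp [h4]⟩ ?_ ?_ ?_ ?_ ?_
        · exact fun a ha => ht.entryBounds _ _ a (Finset.mem_of_mem_erase ha)
        · rintro d rfl a ha b hb
          exact ht.rowWeak _ _ a b ha (Finset.mem_of_mem_erase hb)
        · exact fun a ha b hb => ht.rowWeak _ _ a b (Finset.mem_of_mem_erase ha) hb
        · rintro s rfl a ha b hb
          exact ht.colStrict _ _ a b ha (Finset.mem_of_mem_erase hb)
        · exact fun a ha b hb => ht.colStrict _ _ a b (Finset.mem_of_mem_erase ha) hb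
      refine ht1.updateBox hlt ⟨i, by simp⟩ ?_ ?_ ?_ ?_ ?_
      · intro a ha
        rcases Finset.mem_insert.1 ha with rfl | ha
        · omega
        · exact ht.entryBounds _ _ a ha
      · rintro d hd a ha b hb
        obtain rfl : d = c := by omega
        rw [updateBox_self, Finset.mem_erase] at ha
        have := ht.rowWeak _ _ a _ ha.2 hi
        rcases Finset.mem_insert.1 hb with rfl | hb
        · omega
        · exact ht.rowWeak _ _ a b ha.2 hb
      · intro a ha b hb
        rw [updateBox_of_col_ne (by omega)] at hb
        rcases Finset.mem_insert.1 ha with rfl | ha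
        · have := ht.rowWeak _ _ _ b hi hb
          omega
        · exact ht.rowWeak _ _ a b ha hb
      · rintro s rfl a ha b hb
        rw [updateBox_of_col_ne (by omega)] at ha
        rcases Finset.mem_insert.1 hb with rfl | hb
        · exact hbd s rfl a ha
        · exact ht.colStrict _ _ a b ha hb
      · intro a ha b hb
        rw [updateBox_of_col_ne (by omega)] at hb
        rcases Finset.mem_insert.1 ha with rfl | ha
        · have := ht.colStrict _ _ _ b hi hb
          omega
        · exact ht.colStrict _ _ a b ha hb
    have hback : t = SVTCrystal.updateBox
        (SVTCrystal.updateBox t' r (c + 1) ((t' r (c + 1)).erase i)) r c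
        (insert (i + 1) (t' r c)) := by
      funext s d
      by_cases hsd : s = r ∧ d = c
      · rw [hsd.1, hsd.2, updateBox_self, e2, Finset.insert_erase h2]
      · by_cases hsd' : s = r ∧ d = c + 1
        · rw [hsd'.1, hsd'.2, updateBox_of_col_ne (by omega), updateBox_self, e1,
            Finset.erase_insert hnot]
        · simp only [SVTCrystal.updateBox, if_neg hsd, if_neg hsd']
          rw [e3 s d (by omega)]
    have k1 : ¬ colHas n t' (i + 1) c := by
      rintro ⟨s, hs, hx⟩
      rcases lt_trichotomy s r with h | rfl | h
      · rw [e3 s c (by omega)] at hx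
        exact (ht.lt_of_mem_col hanti h hx h2).false
      · simp [e2] at hx
      · rw [e3 s c (by omega)] at hx
        exact (ht.lt_of_mem_col hanti h h2 hx).false
    have k2 : ((List.range c).map (colBic n t' i)).prod.m = 0 := by
      rw [map_colBic_congr fun d hd s => e3 s d (by rw [List.mem_range] at hd; omega)]
      rw [List.range_succ, List.map_append, List.prod_append, List.map_singleton,
        List.prod_singleton, colBic, if_pos ⟨r, hr, h2⟩, if_pos h3, Bic.minus_mul_plus,
        mul_one] at hm
      exact hm
    have k3 : ((List.range' (c + 1) (lam 0 - (c + 1))).map (colBic n t' i)).prod.p = 0 := by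
      rw [show lam 0 - (c + 1) = lam 0 - (c + 1 + 1) + 1 by omega, List.range'_succ,
        List.map_cons, List.prod_cons, colBic, if_pos ⟨r, hr, by simp [e1, hi]⟩,
        if_pos ⟨r, hr, by simp [e1]⟩, Bic.minus_mul_plus, one_mul,
        map_colBic_congr fun d hd s => e3 s d (by rw [List.mem_range'_1] at hd; omega)]
      exact hp
    refine ⟨hsvt, ?_⟩
    refine hsvt.fStep_reading hanti hr (by simp [e2, h4]) k1 k2 k3
      (fun s hs d => (e3 s d (.inl hs)).symm) ?_
    have := rowWord_move hsvt hin (r := r) (c := c) (by simp [e2, h4]) (by simp [e1])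
      (by simp [e1, hi])
    rwa [← hback] at this
  · set t' := SVTCrystal.updateBox t r c (insert i ((t r c).erase (i + 1))) with ht'
    have e1 : t' r c = insert i ((t r c).erase (i + 1)) := updateBox_self _ _ _ _
    have e3 : ∀ s d, (s ≠ r ∨ d ≠ c) → t' s d = t s d := by
      intro s d hsd
      simp only [ht', SVTCrystal.updateBox]
      rw [if_neg (by omega)]
    have hsvt : IsSVT n lam t' := by
      refine ht.updateBox (ht.lt_of_mem hi) ⟨i, by simp⟩ ?_ ?_ ?_ ?_ ?_
      · intro a ha
        rcases Finset.mem_insert.1 ha with rfl | ha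
        · omega
        · exact ht.entryBounds _ _ a (Finset.mem_of_mem_erase ha)
      · rintro d rfl a ha b hb
        have a1 := ht.rowWeak _ _ a _ ha hi
        have a2 : a ≠ i + 1 := fun e => h2 ⟨by omega, e ▸ ha⟩
        rcases Finset.mem_insert.1 hb with rfl | hb
        · omega
        · exact ht.rowWeak _ _ a b ha (Finset.mem_of_mem_erase hb)
      · intro a ha b hb
        have a1 := ht.rowWeak _ _ _ b hi hb
        rcases Finset.mem_insert.1 ha with rfl | ha
        · omega
        · exact ht.rowWeak _ _ a b (Finset.mem_of_mem_erase ha) hb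
      · rintro s rfl a ha b hb
        rcases Finset.mem_insert.1 hb with rfl | hb
        · exact hbd s rfl a ha
        · exact ht.colStrict _ _ a b ha (Finset.mem_of_mem_erase hb)
      · intro a ha b hb
        rcases Finset.mem_insert.1 ha with rfl | ha
        · have := ht.colStrict _ _ _ b hi hb
          omega
        · exact ht.colStrict _ _ a b (Finset.mem_of_mem_erase ha) hb
    have hback : t = SVTCrystal.updateBox t' r c (insert (i + 1) ((t' r c).erase i)) := by
      funext s d
      by_cases hsd : s = r ∧ d = c
      · rw [hsd.1, hsd.2, updateBox_self, e1, Finset.erase_insert (by simp [hnot]),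
          Finset.insert_erase hi]
      · simp only [SVTCrystal.updateBox, if_neg hsd]
        rw [e3 s d (by omega)]
    have k0 : i + 1 ∉ t' r c := by simp [e1]
    have k1 : ¬ colHas n t' (i + 1) c := by
      rintro ⟨s, hs, hx⟩
      rcases lt_trichotomy s r with h | rfl | h
      · rw [e3 s c (by omega)] at hx
        exact (ht.lt_of_mem_col hanti h hx hi).false
      · exact k0 hx
      · rw [e3 s c (by omega)] at hx
        exact (ht.lt_of_mem_col hanti h hi hx).false
    have k2 : ((List.range c).map (colBic n t' i)).prod.m = 0 := by
      rwa [map_colBic_congr fun d hd s => e3 s d (by rw [List.mem_range] at hd; omega)]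
    have k3 : ((List.range' (c + 1) (lam 0 - (c + 1))).map (colBic n t' i)).prod.p = 0 := by
      rwa [map_colBic_congr fun d hd s => e3 s d (by rw [List.mem_range'_1] at hd; omega)]
    have k4 : i ∉ t' r (c + 1) := by
      rw [e3 r (c + 1) (by omega)]
      intro hx
      have := ht.rowWeak _ _ _ _ hi hx
      omega
    refine ⟨hsvt, ?_⟩
    refine hsvt.fStep_reading hanti hr (by simp [e1]) k1 k2 k3
      (fun s hs d => (e3 s d (.inl hs)).symm) ?_
    have := rowWord_replace hsvt hin (r := r) (c := c) (by simp [e1]) k0 k4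
    rwa [← hback] at this

theorem exists_fRaw (ht : IsSVT n lam t) (hlam : IsPartitionShape n lam)
    (h : 0 < (sig i (reading n lam t)).p) : ∃ t', fRaw n lam i t = some t' := by
  rw [ht.sig_reading hlam.antitone] at h
  obtain ⟨c, hc⟩ := exists_fBoxCol h
  exact Option.ne_none_iff_exists'.1 (fRaw_ne_none hc)

theorem exists_eRaw (ht : IsSVT n lam t) (hlam : IsPartitionShape n lam)
    (h : 0 < (sig i (reading n lam t)).m) : ∃ t', eRaw n lam i t = some t' := by
  rw [ht.sig_reading hlam.antitone] at h
  obtain ⟨c, hc⟩ := exists_eBoxCol h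
  exact Option.ne_none_iff_exists'.1 (eRaw_ne_none hc)

theorem fRaw_eq_none_iff (ht : IsSVT n lam t) (hlam : IsPartitionShape n lam) (hin : i < n) :
    fRaw n lam i t = none ↔ (sig i (reading n lam t)).p = 0 := by
  constructor
  · intro h
    by_contra h'
    obtain ⟨t', ht'⟩ := ht.exists_fRaw hlam (Nat.pos_of_ne_zero h')
    simp [h] at ht'
  · intro h
    by_contra h'
    obtain ⟨t', ht'⟩ := Option.ne_none_iff_exists'.1 h'
    have := (ht.fRaw_spec hlam hin ht').2.1.p_pos
    omega

theorem eRaw_eq_none_iff (ht : IsSVT n lam t) (hlam : IsPartitionShape n lam) (h1i : 1 ≤ i)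
    (hin : i < n) : eRaw n lam i t = none ↔ (sig i (reading n lam t)).m = 0 := by
  constructor
  · intro h
    by_contra h'
    obtain ⟨t', ht'⟩ := ht.exists_eRaw hlam (Nat.pos_of_ne_zero h')
    simp [h] at ht'
  · intro h
    by_contra h'
    obtain ⟨t', ht'⟩ := Option.ne_none_iff_exists'.1 h'
    have := (ht.eRaw_spec hlam h1i hin ht').2.1.m_pos
    omega

end IsSVT

/-! ### Reading words determine tableaux and their weights -/

theorem IsSVT.mem_of_mem_rowWord {n : ℕ} {lam : ℕ → ℕ} {t : Filling} (ht : IsSVT n lam t)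
    {r x : ℕ} (hx : x ∈ rowWord n lam t r) : ∃ c, x ∈ t r c := by
  rw [rowWord, List.mem_append, List.mem_filter, List.mem_map] at hx
  rcases hx with ⟨-, hx⟩ | ⟨c, hc, rfl⟩
  · obtain ⟨c, -, h, -⟩ := of_decide_eq_true hx
    exact ⟨c, h⟩
  · exact ⟨c, boxMin_mem (ht.boxNonempty r c (List.mem_range.1 hc))⟩

theorem IsSVT.bounds_of_mem_reading {n : ℕ} {lam : ℕ → ℕ} {t : Filling} (ht : IsSVT n lam t)
    {x : ℕ} (hx : x ∈ reading n lam t) : 1 ≤ x ∧ x ≤ n := by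
  rw [reading, List.mem_flatMap] at hx
  obtain ⟨r, -, hr⟩ := hx
  obtain ⟨c, hc⟩ := ht.mem_of_mem_rowWord hr
  exact ht.entryBounds r c x hc

theorem eq_of_flatMap_eq {α β : Type*} {f g : α → List β} {L : List α}
    (h : L.flatMap f = L.flatMap g) (hlen : ∀ a ∈ L, (f a).length = (g a).length) :
    ∀ a ∈ L, f a = g a := by
  induction L with
  | nil => simp
  | cons b L ih =>
    rw [List.flatMap_cons, List.flatMap_cons] at h
    obtain ⟨h1, h2⟩ := List.append_inj h (hlen b List.mem_cons_self)
    intro a ha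
    rcases List.mem_cons.1 ha with rfl | ha
    · exact h1
    · exact ih h2 (fun a ha => hlen a (List.mem_cons_of_mem _ ha)) a ha

theorem IsSVT.subset_of_rowWord_eq {n : ℕ} {lam : ℕ → ℕ} {t t' : Filling} (ht : IsSVT n lam t)
    (ht' : IsSVT n lam t') {r : ℕ} (h : rowWord n lam t r = rowWord n lam t' r) (c : ℕ) :
    t r c ⊆ t' r c := by
  rw [rowWord, rowWord] at h
  obtain ⟨h1, h2⟩ := List.append_inj' h (by simp)
  have hmin : ∀ d < lam r, boxMin t r d = boxMin t' r d := fun d hd =>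
    List.map_inj_left.1 h2 d (List.mem_range.2 hd)
  intro x hx
  have hc := ht.lt_of_mem hx
  rcases (boxMin_le hx).eq_or_lt with he | hlt
  · rw [← he, hmin c hc]
    exact boxMin_mem (ht'.boxNonempty r c hc)
  · have hb := (ht.entryBounds r c x hx).2
    have hmem : x ∈ (List.range (n + 1)).reverse.filter (fun x => IsExtra t r (lam r) x) := by
      rw [List.mem_filter, List.mem_reverse, List.mem_range]
      exact ⟨by omega, decide_eq_true ⟨c, hc, hx, hlt⟩⟩
    rw [h1, List.mem_filter] at hmem
    obtain ⟨d, hd, hxd, hd'⟩ := of_decide_eq_true hmem.2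
    rcases lt_trichotomy d c with hdc | rfl | hdc
    · have := ht'.le_boxMin hxd hdc hc
      rw [← hmin c hc] at this
      omega
    · exact hxd
    · have := ht.le_boxMin hx hdc hd
      rw [hmin d hd] at this
      omega

theorem IsSVT.eq_of_reading_eq {n : ℕ} {lam : ℕ → ℕ} {t t' : Filling} (ht : IsSVT n lam t)
    (ht' : IsSVT n lam t') (hlam : IsPartitionShape n lam)
    (h : reading n lam t = reading n lam t')
    (hlen : ∀ r, (rowWord n lam t r).length = (rowWord n lam t' r).length) : t = t' := by
  have hrow := eq_of_flatMap_eq h fun r _ => hlen r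
  funext r c
  by_cases hc : c < lam r
  · have hr : r < n := by
      by_contra hr
      rw [hlam.2 r (by omega)] at hc
      omega
    have := hrow r (by simpa using hr)
    exact (ht.subset_of_rowWord_eq ht' this c).antisymm (ht'.subset_of_rowWord_eq ht this.symm c)
  · rw [ht.emptyOutside r c hc, ht'.emptyOutside r c hc]

theorem rowSig_count (t : Filling) (i r : ℕ) (L : List ℕ) :
    (rowSig t i r L).p + L.countP (fun c => i + 1 ∈ t r c) =
      (rowSig t i r L).m + L.countP (fun c => i ∈ t r c) := by
  induction L with
  | nil => rfl
  | cons c L ih =>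
    rw [rowSig_cons, List.countP_cons, List.countP_cons, Bic.mul_p, Bic.mul_m]
    by_cases h1 : i ∈ t r c <;> by_cases h2 : i + 1 ∈ t r c <;>
      simp [cellSig, h1, h2, Bic.minus_mul_plus, Bic.one_p, Bic.one_m, Bic.plus_p, Bic.plus_m,
        Bic.minus_p, Bic.minus_m] <;> omega

theorem IsSVT.count_rowWord {n : ℕ} {lam : ℕ → ℕ} {t : Filling} (ht : IsSVT n lam t) (r j : ℕ) :
    (rowWord n lam t r).count j = (List.range (lam r)).countP (fun c => j ∈ t r c) := by
  have hbig : ∀ j, n < j →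
      (rowWord n lam t r).count j = (List.range (lam r)).countP (fun c => j ∈ t r c) := by
    intro j hj
    rw [List.count_eq_zero.2, List.countP_eq_zero.2]
    · intro c _ h
      have := (ht.entryBounds r c j (of_decide_eq_true h)).2
      omega
    · intro h
      obtain ⟨c, hc⟩ := ht.mem_of_mem_rowWord h
      have := (ht.entryBounds r c j hc).2
      omega
  have hdown : ∀ k j, n < j + k →
      (rowWord n lam t r).count j = (List.range (lam r)).countP (fun c => j ∈ t r c) := by
    intro k
    induction k with
    | zero => exact hbig
    | succ k ih =>
      intro j hj
      have h1 := ih (j + 1) (by omega)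
      have h2 := sig_count j (rowWord n lam t r)
      have h3 := rowSig_count t j r (List.range (lam r))
      rw [ht.sig_rowWord] at h2
      omega
  exact hdown (n + 1) j (by omega)

theorem IsSVT.wt_eq_count {n : ℕ} {lam : ℕ → ℕ} {t : Filling} (ht : IsSVT n lam t)
    (hlam : Antitone lam) (j : ℕ) : wt n lam t j = (reading n lam t).count j := by
  have h1 : ∀ r, (rowWord n lam t r).count j =
      ((Finset.range (lam 0)).filter fun c => j ∈ t r c).card := by
    intro r
    have e : (Finset.range (lam 0)).filter (fun c => j ∈ t r c) =
        ((List.range (lam r)).filter fun c => j ∈ t r c).toFinset := by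
      ext c
      simp only [Finset.mem_filter, Finset.mem_range, List.mem_toFinset, List.mem_filter,
        List.mem_range, decide_eq_true_eq]
      exact and_congr_left fun h => ⟨fun _ => ht.lt_of_mem h,
        fun h' => h'.trans_le (hlam (Nat.zero_le r))⟩
    rw [ht.count_rowWord, e, List.toFinset_card_of_nodup (List.nodup_range.filter _),
      List.countP_eq_length_filter]
  have h2 : (reading n lam t).count j =
      ∑ r ∈ Finset.range n, (rowWord n lam t r).count j := by
    rw [reading, List.count_flatMap, List.map_reverse, List.sum_reverse]
    rfl
  rw [h2, wt, Finset.card_filter, Finset.sum_product]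
  refine Finset.sum_congr rfl fun r _ => ?_
  rw [h1, Finset.card_filter]

/-! ### Semistandard tableaux -/

theorem IsSSYT.length_rowWord {n : ℕ} {mu : ℕ → ℕ} {p : Filling} (hp : IsSSYT n mu p) (r : ℕ) :
    (rowWord n mu p r).length = mu r := by
  rw [rowWord, List.length_append, List.length_map, List.length_range,
    List.length_eq_zero_iff.2, zero_add]
  rw [List.filter_eq_nil_iff]
  intro x _ hx
  obtain ⟨c, hc, h1, h2⟩ := of_decide_eq_true hx
  have := Finset.card_le_one.1 (hp.2 r c hc).le _ h1 _ (boxMin_mem ⟨x, h1⟩)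
  omega

theorem IsSVT.isSSYT {n : ℕ} {mu : ℕ → ℕ} {p : Filling} (hp : IsSVT n mu p)
    (h : ∀ r, (rowWord n mu p r).length = mu r) : IsSSYT n mu p := by
  refine ⟨hp, fun r c hc => ?_⟩
  have h1 := h r
  rw [rowWord, List.length_append, List.length_map, List.length_range] at h1
  have h2 : (List.range (n + 1)).reverse.filter (fun x => IsExtra p r (mu r) x) = [] :=
    List.length_eq_zero_iff.1 (by omega)
  rw [List.filter_eq_nil_iff] at h2
  rw [Finset.card_eq_one]
  refine ⟨boxMin p r c, Finset.eq_singleton_iff_unique_mem.2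
    ⟨boxMin_mem (hp.boxNonempty r c hc), fun x hx => ?_⟩⟩
  by_contra hne
  have h3 := (hp.entryBounds r c x hx).2
  exact h2 x (by simpa using Nat.lt_succ_of_le h3)
    (decide_eq_true ⟨c, hc, hx, lt_of_le_of_ne (boxMin_le hx) (Ne.symm hne)⟩)

theorem IsSSYT.eq_of_reading_eq {n : ℕ} {mu : ℕ → ℕ} {p p' : Filling} (hp : IsSSYT n mu p)
    (hp' : IsSSYT n mu p') (hmu : IsPartitionShape n mu)
    (h : reading n mu p = reading n mu p') : p = p' :=
  hp.1.eq_of_reading_eq hp'.1 hmu h fun r => by rw [hp.length_rowWord, hp'.length_rowWord]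

theorem IsSVT.yamWord {n : ℕ} {lam : ℕ → ℕ} {t : Filling} (ht : IsSVT n lam t)
    (hlam : IsPartitionShape n lam) (h : IsYamanouchi n lam t) : YamWord (reading n lam t) := by
  refine ⟨fun x hx => (ht.bounds_of_mem_reading hx).1, fun i hi => ?_⟩
  by_cases hin : i < n
  · exact (ht.eRaw_eq_none_iff hlam hi hin).1 (h i hi hin)
  · refine Bic.prod_m_eq_zero fun x hx => ?_
    obtain ⟨y, hy, rfl⟩ := List.mem_map.1 hx
    have := (ht.bounds_of_mem_reading hy).2
    exact letter_m_of_le (by omega)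

theorem IsSVT.isPartitionShape_wt {n : ℕ} {lam : ℕ → ℕ} {t : Filling} (ht : IsSVT n lam t)
    (hlam : IsPartitionShape n lam) (h : IsYamanouchi n lam t) :
    IsPartitionShape n fun r => wt n lam t (r + 1) := by
  constructor
  · intro r
    simp only [ht.wt_eq_count hlam.antitone]
    have h1 := sig_count (r + 1) (reading n lam t)
    rw [(ht.yamWord hlam h).2 (r + 1) (by omega)] at h1
    omega
  · intro r hr
    simp only [ht.wt_eq_count hlam.antitone]
    refine List.count_eq_zero.2 fun hx => ?_
    have := (ht.bounds_of_mem_reading hx).2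
    omega

theorem mem_uTab {mu : ℕ → ℕ} {r c x : ℕ} : x ∈ uTab mu r c ↔ c < mu r ∧ x = r + 1 := by
  unfold uTab
  split_ifs with h <;> simp [h]

theorem isSSYT_uTab {n : ℕ} {mu : ℕ → ℕ} (hmu : IsPartitionShape n mu) :
    IsSSYT n mu (uTab mu) := by
  refine ⟨⟨fun r c h => ⟨r + 1, mem_uTab.2 ⟨h, rfl⟩⟩, fun r c h => by simp [uTab, h],
    fun r c a ha => ?_, fun r c a b ha hb => ?_, fun r c a b ha hb => ?_⟩,
    fun r c h => by simp [uTab, h]⟩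
  · obtain ⟨h1, h2⟩ := mem_uTab.1 ha
    by_contra h3
    rw [hmu.2 r (by omega)] at h1
    omega
  · exact ((mem_uTab.1 ha).2.trans (mem_uTab.1 hb).2.symm).le
  · have h1 := (mem_uTab.1 ha).2
    have h2 := (mem_uTab.1 hb).2
    omega

theorem isYamanouchi_uTab {n : ℕ} {mu : ℕ → ℕ} (hmu : IsPartitionShape n mu) :
    IsYamanouchi n mu (uTab mu) := by
  intro i hi hin
  have hu := (isSSYT_uTab hmu).1
  rw [hu.eRaw_eq_none_iff hmu hi hin, hu.sig_reading hmu.antitone]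
  refine Bic.prod_m_eq_zero fun x hx => ?_
  obtain ⟨c, -, rfl⟩ := List.mem_map.1 hx
  unfold colBic
  split_ifs with h1 h2 h2
  · rfl
  · obtain ⟨r, hr, h⟩ := h1
    obtain ⟨h3, h4⟩ := mem_uTab.1 h
    refine absurd ⟨i - 1, by omega, mem_uTab.2 ⟨h3.trans_le (hmu.antitone ?_), by omega⟩⟩ h2
    omega
  · rfl
  · rfl

theorem wt_uTab {n : ℕ} {mu : ℕ → ℕ} (hmu : IsPartitionShape n mu) (j : ℕ) :
    wt n mu (uTab mu) (j + 1) = mu j := by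
  have e : (Finset.range n ×ˢ Finset.range (mu 0)).filter
      (fun q => j + 1 ∈ uTab mu q.1 q.2) = (Finset.range (mu j)).image fun c => (j, c) := by
    ext ⟨r, c⟩
    simp only [Finset.mem_filter, Finset.mem_product, Finset.mem_range, mem_uTab,
      Finset.mem_image, Prod.mk.injEq]
    constructor
    · rintro ⟨-, h1, h2⟩
      obtain rfl : r = j := by omega
      exact ⟨c, h1, rfl, rfl⟩
    · rintro ⟨c, h, rfl, rfl⟩
      refine ⟨⟨?_, h.trans_le (hmu.antitone (Nat.zero_le _))⟩, h, rfl⟩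
      by_contra h3
      rw [hmu.2 _ (by omega)] at h
      omega
  rw [wt, e, Finset.card_image_of_injective _ (fun a b h => (Prod.mk.inj h).2),
    Finset.card_range]

/-- The only highest weight semistandard tableau of a given shape is `u_μ`. -/
theorem IsSSYT.eq_uTab {n : ℕ} {mu : ℕ → ℕ} {p : Filling} (hp : IsSSYT n mu p)
    (hmu : IsPartitionShape n mu) (h : IsYamanouchi n mu p) : p = uTab mu := by
  have hanti := hmu.antitone
  have hlow : ∀ r c x, x ∈ p r c → r + 1 ≤ x := by
    intro r
    induction r with
    | zero => exact fun c x hx => (hp.1.entryBounds 0 c x hx).1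
    | succ r ih =>
      intro c x hx
      obtain ⟨y, hy⟩ := hp.1.boxNonempty r c ((hp.1.lt_of_mem hx).trans_le (hanti (Nat.le_succ r)))
      have h1 := ih c y hy
      have h2 := hp.1.colStrict r c y x hy hx
      omega
  have hmain : ∀ r c x, x ∈ p r c → x = r + 1 := by
    intro r
    induction r using Nat.strong_induction_on with
    | _ r ih =>
      intro c x hx
      by_contra hne
      have hgt : r + 1 < x := lt_of_le_of_ne (hlow r c x hx) (Ne.symm hne)
      have hc := hp.1.lt_of_mem hx
      obtain ⟨d, hd⟩ : ∃ d, mu r = d + 1 := ⟨mu r - 1, by omega⟩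
      obtain ⟨y, hy, hxy⟩ : ∃ y ∈ p r d, x ≤ y := by
        by_cases hcd : c = d
        · exact ⟨x, hcd ▸ hx, le_rfl⟩
        · obtain ⟨y, hy⟩ := hp.1.boxNonempty r d (by omega)
          exact ⟨y, hy, hp.1.le_of_mem (by omega) hx hy⟩
      obtain ⟨i, rfl⟩ : ∃ i, y = i + 1 := ⟨y - 1, by omega⟩
      have hup : ∀ s e z, s < r → z ∈ p s e → z < i := fun s e z hs hz => by
        have := ih s hs e z hz
        omega
      have hrn := hp.1.row_lt hmu hy
      have hin := (hp.1.entryBounds r d _ hy).2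
      have hsig := (hp.1.eRaw_eq_none_iff hmu (show 1 ≤ i by omega) (by omega)).1
        (h i (by omega) (by omega))
      rw [hp.1.sig_reading hanti, range_split (show d < mu 0 by
        have := hanti (Nat.zero_le r); omega), List.map_append, List.prod_append, Bic.mul_m,
        List.map_cons, List.prod_cons, Bic.mul_m] at hsig
      have hneutral : ((List.range' (d + 1) (mu 0 - (d + 1))).map (colBic n p i)).prod = 1 := by
        refine List.prod_eq_one fun b hb => ?_
        obtain ⟨e, he, rfl⟩ := List.mem_map.1 hb
        rw [List.mem_range'_1] at he
        have hcol : ∀ z, i ≤ z → ¬ colHas n p z e := by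
          rintro z hz ⟨s, hs, hze⟩
          by_cases hsr : s < r
          · have := hup s e z hsr hze
            omega
          · have h1 := hp.1.lt_of_mem hze
            have h2 := hanti (show r ≤ s by omega)
            omega
        rw [colBic, if_neg (hcol _ (by omega)), if_neg (hcol _ le_rfl), one_mul]
      have hcold : colBic n p i d = Bic.minus := by
        have h1 : colHas n p (i + 1) d := ⟨r, hrn, hy⟩
        have h2 : ¬ colHas n p i d := by
          rintro ⟨s, hs, hz⟩
          rcases lt_trichotomy s r with hsr | rfl | hsr
          · exact (hup s d i hsr hz).false
          · have := Finset.card_le_one.1 (hp.2 s d (by omega)).le _ hz _ hy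
            omega
          · have := hp.1.lt_of_mem_col hanti hsr hy hz
            omega
        rw [colBic, if_pos h1, if_neg h2, mul_one]
      rw [hneutral, hcold] at hsig
      simp [Bic.one_p, Bic.minus_m] at hsig
  funext r c
  unfold uTab
  split_ifs with hc
  · exact Finset.eq_singleton_iff_nonempty_unique_mem.2
      ⟨hp.1.boxNonempty r c hc, hmain r c⟩
  · exact hp.1.emptyOutside r c hc

/-! ### Comparing a crystal of set-valued tableaux with a crystal of semistandard tableaux -/

theorem IsSSYT.fRaw_spec {n i : ℕ} {mu : ℕ → ℕ} {p p' : Filling} (hp : IsSSYT n mu p)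
    (hmu : IsPartitionShape n mu) (hin : i < n) (h : fRaw n mu i p = some p') :
    IsSSYT n mu p' ∧ FStep i (reading n mu p) (reading n mu p') := by
  obtain ⟨h1, h2, h3⟩ := hp.1.fRaw_spec hmu hin h
  exact ⟨h1.isSSYT fun r => (h3 r).trans (hp.length_rowWord r), h2⟩

theorem IsSSYT.eRaw_spec {n i : ℕ} {mu : ℕ → ℕ} {p p' : Filling} (hp : IsSSYT n mu p)
    (hmu : IsPartitionShape n mu) (h1i : 1 ≤ i) (hin : i < n) (h : eRaw n mu i p = some p') :
    IsSSYT n mu p' ∧ FStep i (reading n mu p') (reading n mu p) := by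
  obtain ⟨h1, h2, h3⟩ := hp.1.eRaw_spec hmu h1i hin h
  exact ⟨h1.isSSYT fun r => (h3 r).symm.trans (hp.length_rowWord r), h2⟩

/-- The automorphism `Φ` carries the reading word of `t` to that of the semistandard
tableau `p`. -/
structure Matches (n : ℕ) (lam mu : ℕ → ℕ) (Φ : WordAut) (t p : Filling) : Prop where
  isSVT : IsSVT n lam t
  isSSYT : IsSSYT n mu p
  reading_eq : Φ.e (reading n lam t) = reading n mu p

namespace Matches

variable {n i : ℕ} {lam mu : ℕ → ℕ} {Φ : WordAut} {t t' p p' : Filling}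

theorem fRaw_some (h : Matches n lam mu Φ t p) (hlam : IsPartitionShape n lam)
    (hmu : IsPartitionShape n mu) (hin : i < n) (ht' : fRaw n lam i t = some t') :
    ∃ p', fRaw n mu i p = some p' ∧ Matches n lam mu Φ t' p' := by
  obtain ⟨h1, h2, -⟩ := h.isSVT.fRaw_spec hlam hin ht'
  obtain ⟨p', hp'⟩ : ∃ p', fRaw n mu i p = some p' := by
    apply h.isSSYT.1.exists_fRaw hmu
    rw [← h.reading_eq, Φ.p_eq]
    exact h2.p_pos
  obtain ⟨h3, h4⟩ := h.isSSYT.fRaw_spec hmu hin hp'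
  have h5 := Φ.fStep h2
  rw [h.reading_eq] at h5
  exact ⟨p', hp', h1, h3, h5.right_unique h4⟩

theorem fRaw_some_symm (h : Matches n lam mu Φ t p) (hlam : IsPartitionShape n lam)
    (hmu : IsPartitionShape n mu) (hin : i < n) (hp' : fRaw n mu i p = some p') :
    ∃ t', fRaw n lam i t = some t' ∧ Matches n lam mu Φ t' p' := by
  obtain ⟨-, h2⟩ := h.isSSYT.fRaw_spec hmu hin hp'
  obtain ⟨t', ht'⟩ : ∃ t', fRaw n lam i t = some t' := by
    apply h.isSVT.exists_fRaw hlam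
    rw [← Φ.p_eq, h.reading_eq]
    exact h2.p_pos
  obtain ⟨p'', hp'', hm⟩ := h.fRaw_some hlam hmu hin ht'
  rw [hp', Option.some_inj] at hp''
  exact ⟨t', ht', hp'' ▸ hm⟩

theorem eRaw_some (h : Matches n lam mu Φ t p) (hlam : IsPartitionShape n lam)
    (hmu : IsPartitionShape n mu) (h1i : 1 ≤ i) (hin : i < n) (ht' : eRaw n lam i t = some t') :
    ∃ p', eRaw n mu i p = some p' ∧ Matches n lam mu Φ t' p' := by
  obtain ⟨h1, h2, -⟩ := h.isSVT.eRaw_spec hlam h1i hin ht'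
  obtain ⟨p', hp'⟩ : ∃ p', eRaw n mu i p = some p' := by
    apply h.isSSYT.1.exists_eRaw hmu
    rw [← h.reading_eq, Φ.m_eq]
    exact h2.m_pos
  obtain ⟨h3, h4⟩ := h.isSSYT.eRaw_spec hmu h1i hin hp'
  have h5 := Φ.fStep h2
  rw [h.reading_eq] at h5
  exact ⟨p', hp', h1, h3, h5.left_unique h4⟩

theorem fRaw_eq_none_iff (h : Matches n lam mu Φ t p) (hlam : IsPartitionShape n lam)
    (hmu : IsPartitionShape n mu) (hin : i < n) :
    fRaw n lam i t = none ↔ fRaw n mu i p = none := by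
  rw [h.isSVT.fRaw_eq_none_iff hlam hin, h.isSSYT.1.fRaw_eq_none_iff hmu hin, ← h.reading_eq,
    Φ.p_eq]

theorem eRaw_eq_none_iff (h : Matches n lam mu Φ t p) (hlam : IsPartitionShape n lam)
    (hmu : IsPartitionShape n mu) (h1i : 1 ≤ i) (hin : i < n) :
    eRaw n lam i t = none ↔ eRaw n mu i p = none := by
  rw [h.isSVT.eRaw_eq_none_iff hlam h1i hin, h.isSSYT.1.eRaw_eq_none_iff hmu h1i hin,
    ← h.reading_eq, Φ.m_eq]

theorem wt_eq (h : Matches n lam mu Φ t p) (hlam : IsPartitionShape n lam)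
    (hmu : IsPartitionShape n mu) (j : ℕ) : wt n mu p j = wt n lam t j := by
  rw [h.isSVT.wt_eq_count hlam.antitone, h.isSSYT.1.wt_eq_count hmu.antitone, ← h.reading_eq,
    Φ.count_eq]

theorem right_unique (h : Matches n lam mu Φ t p) (h' : Matches n lam mu Φ t p')
    (hmu : IsPartitionShape n mu) : p = p' :=
  h.isSSYT.eq_of_reading_eq h'.isSSYT hmu (h.reading_eq.symm.trans h'.reading_eq)

theorem left_unique (h : Matches n lam mu Φ t p) (h' : Matches n lam mu Φ t' p)
    (hlam : IsPartitionShape n lam)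
    (hlen : ∀ r, (rowWord n lam t r).length = (rowWord n lam t' r).length) : t = t' :=
  h.isSVT.eq_of_reading_eq h'.isSVT hlam
    (Φ.e.injective (h.reading_eq.trans h'.reading_eq.symm)) hlen

end Matches

/-! ### Raising a tableau to a Yamanouchi tableau -/

/-- `y` is obtained from `t` by applying operators `e_i` with `1 ≤ i < n`. -/
def Raises (n : ℕ) (lam : ℕ → ℕ) : Filling → Filling → Prop :=
  Relation.ReflTransGen fun t t' => ∃ i, 1 ≤ i ∧ i < n ∧ eRaw n lam i t = some t'

section Raises

variable {n i : ℕ} {lam mu : ℕ → ℕ} {t t' y y' p : Filling}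

theorem Raises.of_eRaw (h1i : 1 ≤ i) (hin : i < n) (h : eRaw n lam i t = some t')
    (hy : Raises n lam t' y) : Raises n lam t y :=
  Relation.ReflTransGen.head ⟨i, h1i, hin, h⟩ hy

theorem IsSVT.eRaw_of_fRaw (ht : IsSVT n lam t) (hlam : IsPartitionShape n lam) (h1i : 1 ≤ i)
    (hin : i < n) (h : fRaw n lam i t = some t') : eRaw n lam i t' = some t := by
  obtain ⟨h1, h2, h3⟩ := ht.fRaw_spec hlam hin h
  obtain ⟨s, hs⟩ := h1.exists_eRaw hlam h2.m_pos
  obtain ⟨h4, h5, h6⟩ := h1.eRaw_spec hlam h1i hin hs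
  rw [hs, h4.eq_of_reading_eq ht hlam (h5.left_unique h2) fun r => (h6 r).symm.trans (h3 r)]

theorem IsSVT.fRaw_of_eRaw (ht : IsSVT n lam t) (hlam : IsPartitionShape n lam) (h1i : 1 ≤ i)
    (hin : i < n) (h : eRaw n lam i t = some t') : fRaw n lam i t' = some t := by
  obtain ⟨h1, h2, h3⟩ := ht.eRaw_spec hlam h1i hin h
  obtain ⟨s, hs⟩ := h1.exists_fRaw hlam h2.p_pos
  obtain ⟨h4, h5, h6⟩ := h1.fRaw_spec hlam hin hs
  rw [hs, h4.eq_of_reading_eq ht hlam (h5.right_unique h2) fun r => (h6 r).trans (h3 r).symm]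

theorem IsSVT.exists_raises (ht : IsSVT n lam t) (hlam : IsPartitionShape n lam) :
    ∃ y, IsSVT n lam y ∧ IsYamanouchi n lam y ∧ Raises n lam t y := by
  induction hk : (reading n lam t).sum generalizing t with
  | zero =>
    refine ⟨t, ht, fun i h1i hin => ?_, Relation.ReflTransGen.refl⟩
    by_contra h
    obtain ⟨t', h'⟩ := Option.ne_none_iff_exists'.1 h
    have := (ht.eRaw_spec hlam h1i hin h').2.1.sum_eq
    omega
  | succ k ih =>
    by_cases h : IsYamanouchi n lam t
    · exact ⟨t, ht, h, Relation.ReflTransGen.refl⟩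
    · simp only [IsYamanouchi, not_forall] at h
      obtain ⟨i, h1i, hin, h⟩ := h
      obtain ⟨t', h'⟩ := Option.ne_none_iff_exists'.1 h
      obtain ⟨h1, h2, -⟩ := ht.eRaw_spec hlam h1i hin h'
      obtain ⟨y, hy, hyy, hty⟩ := ih h1 (by have := h2.sum_eq; omega)
      exact ⟨y, hy, hyy, hty.of_eRaw h1i hin h'⟩

theorem Raises.length_rowWord (h : Raises n lam t y) (ht : IsSVT n lam t)
    (hlam : IsPartitionShape n lam) (r : ℕ) :
    (rowWord n lam t r).length = (rowWord n lam y r).length := by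
  induction h using Relation.ReflTransGen.head_induction_on with
  | refl => rfl
  | head h _ ih =>
    obtain ⟨i, h1i, hin, h⟩ := h
    obtain ⟨h1, -, h3⟩ := ht.eRaw_spec hlam h1i hin h
    exact (h3 r).trans (ih h1)

theorem Raises.matches_left {Φ : WordAut} (h : Raises n lam t y) (ht : IsSVT n lam t)
    (hlam : IsPartitionShape n lam) (hmu : IsPartitionShape n mu)
    (hy : Matches n lam mu Φ y p) : ∃ q, Matches n lam mu Φ t q := by
  induction h using Relation.ReflTransGen.head_induction_on with
  | refl => exact ⟨p, hy⟩
  | head h _ ih =>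
    obtain ⟨i, h1i, hin, h⟩ := h
    obtain ⟨q, hq⟩ := ih (ht.eRaw_spec hlam h1i hin h).1
    obtain ⟨q', -, hq'⟩ := hq.fRaw_some hlam hmu hin (ht.fRaw_of_eRaw hlam h1i hin h)
    exact ⟨q', hq'⟩

theorem Raises.matches_right {Φ : WordAut} (h : Raises n lam t y)
    (hlam : IsPartitionShape n lam) (hmu : IsPartitionShape n mu)
    (ht : Matches n lam mu Φ t p) : ∃ q, Matches n lam mu Φ y q := by
  induction h with
  | refl => exact ⟨p, ht⟩
  | tail _ h ih =>
    obtain ⟨i, h1i, hin, h⟩ := h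
    obtain ⟨q, hq⟩ := ih
    obtain ⟨q', -, hq'⟩ := hq.eRaw_some hlam hmu h1i hin h
    exact ⟨q', hq'⟩

theorem IsSVT.exists_matches_uTab (hy : IsSVT n lam y) (hlam : IsPartitionShape n lam)
    (h : IsYamanouchi n lam y) :
    ∃ Φ, Matches n lam (fun r => wt n lam y (r + 1)) Φ y (uTab fun r => wt n lam y (r + 1)) := by
  have hmu := hy.isPartitionShape_wt hlam h
  have hu := isSSYT_uTab hmu
  obtain ⟨Φ, hΦ⟩ := (hy.yamWord hlam h).wordEquiv (hu.1.yamWord hmu (isYamanouchi_uTab hmu))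
    (fun j => by
      cases j with
      | zero =>
        rw [List.count_eq_zero_of_not_mem, List.count_eq_zero_of_not_mem]
        · exact fun h0 => absurd (hu.1.bounds_of_mem_reading h0).1 (by omega)
        · exact fun h0 => absurd (hy.bounds_of_mem_reading h0).1 (by omega)
      | succ j => rw [← hy.wt_eq_count hlam.antitone, ← hu.1.wt_eq_count hmu.antitone, wt_uTab hmu])
  exact ⟨Φ, hy, hu, hΦ⟩

theorem Raises.unique (h : Raises n lam t y) (h' : Raises n lam t y') (ht : IsSVT n lam t)
    (hlam : IsPartitionShape n lam) (hy : IsSVT n lam y) (hyy : IsYamanouchi n lam y)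
    (hyy' : IsYamanouchi n lam y') : y = y' := by
  obtain ⟨Φ, hΦ⟩ := hy.exists_matches_uTab hlam hyy
  have hmu := hy.isPartitionShape_wt hlam hyy
  obtain ⟨p, hp⟩ := h.matches_left ht hlam hmu hΦ
  obtain ⟨q, hq⟩ := h'.matches_right hlam hmu hp
  have hqu := hq.isSSYT.eq_uTab hmu fun i h1i hin =>
    (hq.eRaw_eq_none_iff hlam hmu h1i hin).1 (hyy' i h1i hin)
  subst hqu
  exact hΦ.left_unique hq hlam fun r =>
    (h.length_rowWord ht hlam r).symm.trans (h'.length_rowWord ht hlam r)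

theorem Raises.lift {Φ : WordAut} {q : Filling} (h : Raises n mu p q) (hp : IsSSYT n mu p)
    (hlam : IsPartitionShape n lam) (hmu : IsPartitionShape n mu) (hy : Matches n lam mu Φ y q) :
    ∃ t, Raises n lam t y ∧ Matches n lam mu Φ t p := by
  induction h using Relation.ReflTransGen.head_induction_on with
  | refl => exact ⟨y, Relation.ReflTransGen.refl, hy⟩
  | head h _ ih =>
    obtain ⟨i, h1i, hin, h⟩ := h
    obtain ⟨t, hty, ht⟩ := ih (hp.eRaw_spec hmu h1i hin h).1
    obtain ⟨t', ht', hm⟩ := ht.fRaw_some_symm hlam hmu hin (hp.1.fRaw_of_eRaw hmu h1i hin h)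
    exact ⟨t', hty.of_eRaw h1i hin (ht.isSVT.eRaw_of_fRaw hlam h1i hin ht'), hm⟩

theorem IsSSYT.raises_uTab (hp : IsSSYT n mu p) (hmu : IsPartitionShape n mu) :
    Raises n mu p (uTab mu) := by
  obtain ⟨q, -, hqy, hpq⟩ := hp.1.exists_raises hmu
  have hq : IsSSYT n mu q := by
    clear hqy
    induction hpq with
    | refl => exact hp
    | tail _ h ih =>
      obtain ⟨i, h1i, hin, h⟩ := h
      exact (ih.eRaw_spec hmu h1i hin h).1
  rwa [← hq.eq_uTab hmu hqy]

end Raises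

/-- there is a weight-preserving bijection from `SVT^n(λ)` onto the
disjoint union over partitions `μ` of `Y_μ(λ) × SSYT^n(μ)` (here `Y t` is the Yamanouchi
component label, of weight `μ`, and `P t` is the `SSYT^n(μ)` component) intertwining the
crystal operators, which act on the `SSYT^n(μ)` factor only.  In particular `SVT^n(λ)`
decomposes as a direct sum of the crystals `SSYT^n(μ)` with multiplicities `|Y_μ(λ)|`. -/
theorem svt_crystal_decomposition (n : ℕ) (lam : ℕ → ℕ) (hlam : IsPartitionShape n lam) :
    ∃ Y P : Filling → Filling,
      (∀ t, IsSVT n lam t →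
        IsSVT n lam (Y t) ∧ IsYamanouchi n lam (Y t) ∧
        IsSSYT n (fun r => wt n lam (Y t) (r + 1)) (P t) ∧
        (∀ j, wt n (fun r => wt n lam (Y t) (r + 1)) (P t) j = wt n lam t j)) ∧
      (∀ t t', IsSVT n lam t → IsSVT n lam t' → Y t = Y t' → P t = P t' → t = t') ∧
      (∀ y p, IsSVT n lam y → IsYamanouchi n lam y →
        IsSSYT n (fun r => wt n lam y (r + 1)) p →
        ∃ t, IsSVT n lam t ∧ Y t = y ∧ P t = p) ∧
      (∀ t, IsSVT n lam t → ∀ i, 1 ≤ i → i < n →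
        (fRaw n lam i t = none ↔
          fRaw n (fun r => wt n lam (Y t) (r + 1)) i (P t) = none) ∧
        (∀ t', fRaw n lam i t = some t' → Y t' = Y t ∧
          fRaw n (fun r => wt n lam (Y t) (r + 1)) i (P t) = some (P t')) ∧
        (eRaw n lam i t = none ↔
          eRaw n (fun r => wt n lam (Y t) (r + 1)) i (P t) = none) ∧
        (∀ t', eRaw n lam i t = some t' → Y t' = Y t ∧
          eRaw n (fun r => wt n lam (Y t) (r + 1)) i (P t) = some (P t'))) := by
  have : Nonempty WordAut := ⟨WordAut.refl⟩
  choose! Y hY hYY hYr using fun t (ht : IsSVT n lam t) => ht.exists_raises hlam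
  choose! Φ hΦ using fun y (hy : IsSVT n lam y) => hy.exists_matches_uTab hlam
  have hmu : ∀ y, IsSVT n lam y → IsYamanouchi n lam y →
      IsPartitionShape n fun r => wt n lam y (r + 1) :=
    fun y hy h => hy.isPartitionShape_wt hlam h
  choose! P hP using fun t (ht : IsSVT n lam t) =>
    (hYr t ht).matches_left ht hlam (hmu _ (hY t ht) (hYY t ht)) (hΦ _ (hY t ht) (hYY t ht))
  have hYeq : ∀ t y, IsSVT n lam t → IsSVT n lam y → IsYamanouchi n lam y → Raises n lam t y →
      Y t = y := fun t y ht _ hy h =>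
    (hYr t ht).unique h ht hlam (hY t ht) (hYY t ht) hy
  refine ⟨Y, P, fun t ht => ⟨hY t ht, hYY t ht, (hP t ht).isSSYT,
    (hP t ht).wt_eq hlam (hmu _ (hY t ht) (hYY t ht))⟩, fun t t' ht ht' h h' => ?_,
    fun y p hy hyy hp => ?_, fun t ht i h1i hin => ⟨?_, fun t' h => ?_, ?_, fun t' h => ?_⟩⟩
  · have h2 := hP t' ht'
    rw [← h, ← h'] at h2
    refine (hP t ht).left_unique h2 hlam fun r => ?_
    rw [(hYr t ht).length_rowWord ht hlam, (hYr t' ht').length_rowWord ht' hlam, h]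
  · obtain ⟨t, hty, hm⟩ := (hp.raises_uTab (hmu y hy hyy)).lift hp hlam (hmu y hy hyy) (hΦ y hy hyy)
    have ht := hm.isSVT
    have h := hYeq t y ht hy hyy hty
    subst h
    exact ⟨t, ht, rfl, (hP t ht).right_unique hm (hmu _ hy hyy)⟩
  · exact (hP t ht).fRaw_eq_none_iff hlam (hmu _ (hY t ht) (hYY t ht)) hin
  · have ht' := (ht.fRaw_spec hlam hin h).1
    have hYt := hYeq t' (Y t) ht' (hY t ht) (hYY t ht)
      ((hYr t ht).of_eRaw h1i hin (ht.eRaw_of_fRaw hlam h1i hin h))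
    obtain ⟨p', hp', hm⟩ := (hP t ht).fRaw_some hlam (hmu _ (hY t ht) (hYY t ht)) hin h
    have h2 := hP t' ht'
    rw [hYt] at h2
    exact ⟨hYt, hm.right_unique h2 (hmu _ (hY t ht) (hYY t ht)) ▸ hp'⟩
  · exact (hP t ht).eRaw_eq_none_iff hlam (hmu _ (hY t ht) (hYY t ht)) h1i hin
  · have ht' := (ht.eRaw_spec hlam h1i hin h).1
    have hYt := hYeq t (Y t') ht (hY t' ht') (hYY t' ht') ((hYr t' ht').of_eRaw h1i hin h)
    obtain ⟨p', hp', hm⟩ := (hP t ht).eRaw_some hlam (hmu _ (hY t ht) (hYY t ht)) h1i hin h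
    have h2 := hP t' ht'
    rw [← hYt] at h2
    exact ⟨hYt.symm, hm.right_unique h2 (hmu _ (hY t ht) (hYY t ht)) ▸ hp'⟩

end SVTCrystal

end
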